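/- arXiv:2601.16972 — 3 statements merged into one kernel-verified Lean document; each statement's English description precedes it below -/
import Mathlib

section
/- For all sufficiently large positive integers n, there exists a positive integer m such that f(n, m) - f(n, n) > 0.36 · n · log n / log log n. (Here log denotes the natural logarithm.) -/
open Real

/-- `f n m` is the least nonnegative integer `L` such that the interval `(m, m + L]`
contains `n` distinct integers `a 1, ..., a n` with `i ∣ a i` for all `1 ≤ i ≤ n`. -/
noncomputable def f (n m : ℕ) : ℕ :=
  sInf {L : ℕ | ∃ a : ℕ → ℕ,
    (∀ i ∈ Finset.Icc 1 n, i ∣ a i) ∧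
    (∀ i ∈ Finset.Icc 1 n, m < a i ∧ a i ≤ m + L) ∧
    Set.InjOn a (Finset.Icc 1 n)}

/-- There are many prime powers between `z` and `16 z`, counted with von Mangoldt weights. -/
theorem le_sum_vonMangoldt_Ioc (z : ℕ) :
    (z : ℝ) ≤ ∑ d ∈ Finset.Ioc z (16 * z), ArithmeticFunction.vonMangoldt d := by
  rcases Nat.eq_zero_or_pos z with rfl | hz
  · simp
  have h1 := Chebyshev.psi_ge (16 * z)
  have h2 := Chebyshev.psi_le_const_mul_self (x := (z : ℝ)) (by positivity)
  have h3 : Chebyshev.psi ((16 * z : ℕ) : ℝ) = Chebyshev.psi (z : ℝ) +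
      ∑ d ∈ Finset.Ioc z (16 * z), ArithmeticFunction.vonMangoldt d := by
    unfold Chebyshev.psi
    simp only [Nat.floor_natCast]
    rw [Finset.sum_Ioc_consecutive _ (by omega) (by omega)]
  have hz1 : (1 : ℝ) ≤ z := by exact_mod_cast hz
  have h4 : Real.log (((16 * z : ℕ) : ℝ) + 1) ≤ 5 * Real.log 2 + (z - 1) := by
    calc Real.log (((16 * z : ℕ) : ℝ) + 1) ≤ Real.log (2 ^ 5 * z) := by
          apply Real.log_le_log (by positivity)
          push_cast; linarith
      _ = 5 * Real.log 2 + Real.log z := by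
          rw [Real.log_mul (by norm_num) (by positivity), Real.log_pow]; norm_num
      _ ≤ _ := by linarith [Real.log_le_sub_one_of_pos (show (0 : ℝ) < z by linarith)]
  have h5 : Real.log 4 = 2 * Real.log 2 := by
    rw [show (4 : ℝ) = 2 ^ 2 by norm_num, Real.log_pow]; norm_num
  rw [h5] at h2
  push_cast at h1 h3 h4
  have h6 := Real.log_two_gt_d9
  have h7 := Real.log_two_lt_d9
  nlinarith

/-- Small integers can be matched to distinct multiples in `(u n, 32 u n]`. -/
theorem exists_injective_multiples (n u : ℕ) (hu : 0 < u)
    (h : Real.log (32 * u * n) ≤ 2 * u ^ 2) :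
    ∃ g : {i : ℕ // 0 < i ∧ i * u ≤ n} → ℕ, Function.Injective g ∧
      ∀ i, i.1 ∣ g i ∧ u * n < g i ∧ g i ≤ 32 * u * n := by
  classical
  let z : {i : ℕ // 0 < i ∧ i * u ≤ n} → ℕ := fun i => 2 * u * (n / i.1)
  let t : {i : ℕ // 0 < i ∧ i * u ≤ n} → Finset ℕ := fun i =>
    (Finset.Ioc (z i) (16 * z i)).image (i.1 * ·)
  have hq : ∀ i : {i : ℕ // 0 < i ∧ i * u ≤ n}, u ≤ n / i.1 := fun i => by
    rw [Nat.le_div_iff_mul_le i.2.1, mul_comm]; exact i.2.2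
  have ht : ∀ i, ∀ x ∈ t i, i.1 ∣ x ∧ u * n < x ∧ x ≤ 32 * u * n := by
    intro i x hx
    simp only [t, Finset.mem_image, Finset.mem_Ioc] at hx
    obtain ⟨d, ⟨hd1, hd2⟩, rfl⟩ := hx
    have h1 : n < i.1 * (n / i.1 + 1) := Nat.lt_mul_div_succ n i.2.1
    have h2 : i.1 * (n / i.1) ≤ n := Nat.mul_div_le n i.1
    have h3 := hq i
    have hi := i.2.1
    refine ⟨dvd_mul_right _ _, ?_, ?_⟩
    · calc u * n ≤ u * (i.1 * (2 * (n / i.1))) := by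
            gcongr
            refine h1.le.trans ?_
            gcongr
            omega
        _ = i.1 * z i := by simp only [z]; ring
        _ < i.1 * d := by gcongr
    · calc i.1 * d ≤ i.1 * (16 * z i) := by gcongr
        _ = 32 * u * (i.1 * (n / i.1)) := by simp only [z]; ring
        _ ≤ 32 * u * n := by gcongr
  have hall : ∀ s : Finset {i : ℕ // 0 < i ∧ i * u ≤ n}, s.card ≤ (s.biUnion t).card := by
    intro s
    rcases s.eq_empty_or_nonempty with rfl | ⟨i₀, hi₀⟩
    · simp
    have hn : 0 < n := lt_of_lt_of_le (Nat.mul_pos i₀.2.1 hu) i₀.2.2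
    set D := Real.log (32 * u * n) with hD
    have hDpos : 0 < D := by
      apply Real.log_pos
      have : 1 ≤ u * n := Nat.mul_pos hu hn
      have : (1 : ℝ) ≤ u * n := by exact_mod_cast this
      linarith
    have lower : s.card * D ≤ ∑ i ∈ s, ∑ d ∈ Finset.Ioc (z i) (16 * z i),
        ArithmeticFunction.vonMangoldt d := by
      rw [← nsmul_eq_mul]
      apply Finset.card_nsmul_le_sum
      intro i _
      refine h.trans (le_trans ?_ (le_sum_vonMangoldt_Ioc (z i)))
      have : 2 * u ^ 2 ≤ z i := by
        simp only [z]
        nlinarith [hq i]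
      exact_mod_cast this
    have middle : ∑ i ∈ s, ∑ d ∈ Finset.Ioc (z i) (16 * z i), ArithmeticFunction.vonMangoldt d
        ≤ ∑ x ∈ s.biUnion t, ∑ d ∈ x.divisors, ArithmeticFunction.vonMangoldt d := by
      rw [Finset.sum_sigma', Finset.sum_sigma']
      let e : (Σ _ : {i : ℕ // 0 < i ∧ i * u ≤ n}, ℕ) → (Σ _ : ℕ, ℕ) :=
        fun p => ⟨p.1.1 * p.2, p.2⟩
      rw [← Finset.sum_image (s := s.sigma fun i => Finset.Ioc (z i) (16 * z i)) (g := e)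
        (f := fun p => ArithmeticFunction.vonMangoldt p.2)]
      · apply Finset.sum_le_sum_of_subset_of_nonneg
        · intro p hp
          simp only [Finset.mem_image, Finset.mem_sigma, e] at hp
          obtain ⟨⟨i, d⟩, ⟨hi, hd⟩, rfl⟩ := hp
          have hd0 : 0 < d := (Nat.zero_le _).trans_lt (Finset.mem_Ioc.1 hd).1
          have hi0 := i.2.1
          simp only [Finset.mem_sigma, Finset.mem_biUnion, Nat.mem_divisors]
          exact ⟨⟨i, hi, Finset.mem_image_of_mem _ hd⟩, dvd_mul_left _ _, by positivity⟩
        · intro _ _ _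
          exact ArithmeticFunction.vonMangoldt_nonneg
      · rintro ⟨i, d⟩ hid ⟨j, d'⟩ hjd hij
        simp only [e, Sigma.mk.injEq, heq_eq_eq] at hij
        obtain ⟨h1, rfl⟩ := hij
        simp only [Finset.coe_sigma, Set.mem_sigma_iff, Finset.mem_coe, Finset.mem_Ioc] at hid
        have hd0 : 0 < d := (Nat.zero_le _).trans_lt hid.2.1
        have : i = j := Subtype.ext (Nat.eq_of_mul_eq_mul_right hd0 h1)
        rw [this]
    have upper : ∑ x ∈ s.biUnion t, ∑ d ∈ x.divisors, ArithmeticFunction.vonMangoldt d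
        ≤ (s.biUnion t).card * D := by
      rw [← nsmul_eq_mul]
      apply Finset.sum_le_card_nsmul
      intro x hx
      rw [ArithmeticFunction.vonMangoldt_sum]
      obtain ⟨i, _, hx⟩ := Finset.mem_biUnion.1 hx
      obtain ⟨-, h1, h2⟩ := ht i x hx
      apply Real.log_le_log
      · have : 0 < x := by omega
        exact_mod_cast this
      · exact_mod_cast h2
    have := (lower.trans middle).trans upper
    exact_mod_cast le_of_mul_le_mul_right this hDpos
  obtain ⟨g, hg1, hg2⟩ := (Finset.all_card_le_biUnion_card_iff_exists_injective t).1 hall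
  exact ⟨g, hg1, fun i => ht i _ (hg2 i)⟩

theorem f_self_le (n u : ℕ) (hu : 0 < u) (h : Real.log (32 * u * n) ≤ 2 * u ^ 2) :
    f n n ≤ 32 * u * n := by
  classical
  obtain ⟨g, hg, hg'⟩ := exists_injective_multiples n u hu h
  let a : ℕ → ℕ := fun i => if hi : 0 < i ∧ i * u ≤ n then g ⟨i, hi⟩
    else i * ((n / i) * (n / i + 1))
  have small : ∀ i (hi : 0 < i ∧ i * u ≤ n), a i = g ⟨i, hi⟩ := fun i hi => by
    simp only [a, dif_pos hi]
  have large : ∀ i, i ∈ Finset.Icc 1 n → ¬ (0 < i ∧ i * u ≤ n) →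
      i ∣ a i ∧ n * (n / i) < a i ∧ a i ≤ n * (n / i + 1) ∧ n / i < u ∧ 0 < n / i ∧
        a i = i * ((n / i) * (n / i + 1)) := by
    intro i hi hiu
    have hi' := Finset.mem_Icc.1 hi
    have e : a i = i * ((n / i) * (n / i + 1)) := by simp only [a, dif_neg hiu]
    have h1 : n < i * (n / i + 1) := Nat.lt_mul_div_succ n hi'.1
    have h2 : i * (n / i) ≤ n := Nat.mul_div_le n i
    have h3 : 0 < n / i := Nat.div_pos hi'.2 hi'.1
    refine ⟨by rw [e]; exact dvd_mul_right _ _, ?_, ?_, ?_, h3, e⟩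
    · rw [e]; nlinarith
    · rw [e]; nlinarith
    · rw [Nat.div_lt_iff_lt_mul hi'.1]
      have : ¬ (i * u ≤ n) := fun hh => hiu ⟨hi'.1, hh⟩
      rw [mul_comm]; omega
  apply Nat.sInf_le
  refine ⟨a, ?_, ?_, ?_⟩
  · intro i hi
    by_cases hiu : 0 < i ∧ i * u ≤ n
    · rw [small i hiu]; exact (hg' _).1
    · exact (large i hi hiu).1
  · intro i hi
    by_cases hiu : 0 < i ∧ i * u ≤ n
    · rw [small i hiu]
      obtain ⟨-, h1, h2⟩ := hg' ⟨i, hiu⟩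
      constructor
      · nlinarith
      · omega
    · obtain ⟨-, h1, h2, h3, h4, -⟩ := large i hi hiu
      constructor
      · nlinarith
      · nlinarith
  · intro i hi j hj hij
    by_cases hiu : 0 < i ∧ i * u ≤ n <;> by_cases hju : 0 < j ∧ j * u ≤ n
    · rw [small i hiu, small j hju] at hij
      exact congrArg Subtype.val (hg hij)
    · rw [small i hiu] at hij
      obtain ⟨-, h1, h2⟩ := hg' ⟨i, hiu⟩
      obtain ⟨-, h3, h4, h5, -⟩ := large j hj hju
      have : n * (n / j + 1) ≤ n * u := by gcongr; omega
      nlinarith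
    · rw [small j hju] at hij
      obtain ⟨-, h1, h2⟩ := hg' ⟨j, hju⟩
      obtain ⟨-, h3, h4, h5, -⟩ := large i hi hiu
      have : n * (n / i + 1) ≤ n * u := by gcongr; omega
      nlinarith
    · obtain ⟨-, h3, h4, h5, h6, e1⟩ := large i hi hiu
      obtain ⟨-, h3', h4', h5', h6', e2⟩ := large j hj hju
      have hq : n / i = n / j := by
        apply le_antisymm
        · have : n * (n / i) < n * (n / j + 1) := by omega
          have := lt_of_mul_lt_mul_left this (Nat.zero_le n)
          omega
        · have : n * (n / j) < n * (n / i + 1) := by omega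
          have := lt_of_mul_lt_mul_left this (Nat.zero_le n)
          omega
      rw [e1, e2, hq] at hij
      exact Nat.eq_of_mul_eq_mul_right (by positivity) hij

/-- Unless `L < f n m`, there is a matching into `(m, m + L]`. -/
theorem exists_matching_of_f_le {n m L : ℕ} (h : f n m ≤ L) : ∃ a : ℕ → ℕ,
    (∀ i ∈ Finset.Icc 1 n, i ∣ a i) ∧
    (∀ i ∈ Finset.Icc 1 n, m < a i ∧ a i ≤ m + L) ∧
    Set.InjOn a (Finset.Icc 1 n) := by
  have hne : {L : ℕ | ∃ a : ℕ → ℕ,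
      (∀ i ∈ Finset.Icc 1 n, i ∣ a i) ∧
      (∀ i ∈ Finset.Icc 1 n, m < a i ∧ a i ≤ m + L) ∧
      Set.InjOn a (Finset.Icc 1 n)}.Nonempty := by
    refine ⟨n * (m + 1), fun i => i * (m + 1), fun i _ => dvd_mul_right _ _, ?_, ?_⟩
    · intro i hi
      have hi' := Finset.mem_Icc.1 hi
      constructor <;> nlinarith
    · intro i _ j _ hij
      exact Nat.eq_of_mul_eq_mul_right (Nat.succ_pos m) hij
  obtain ⟨a, h1, h2, h3⟩ := Nat.sInf_mem hne
  refine ⟨a, h1, fun i hi => ⟨(h2 i hi).1, (h2 i hi).2.trans ?_⟩, h3⟩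
  exact Nat.add_le_add_left h m

/-- Pairs consisting of an exponent vector on the odd primes up to `z`, bounded by `b`, and an
exponent vector on the primes in `(z, y]` of total degree at most `h`. The second vector has an
additional coordinate at `0` that makes its total degree equal to `h`. -/
noncomputable def exponentPairs (z y b h : ℕ) : Finset ((ℕ →₀ ℕ) × (ℕ →₀ ℕ)) :=
  ((Finset.Icc 3 z).filter Nat.Prime).finsupp (fun _ => Finset.range (b + 1)) ×ˢ
    (insert 0 ((Finset.Ioc z y).filter Nat.Prime)).finsuppAntidiag h

theorem choose_succ_le_two_mul {r h : ℕ} (hr : r ≤ h) :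
    (r + (h + 1)).choose (h + 1) ≤ 2 * (r + h).choose h := by
  have := Nat.add_one_mul_choose_eq (r + h) h
  have h2 : (r + h + 1) * (r + h).choose h ≤ (2 * (h + 1)) * (r + h).choose h := by
    gcongr; omega
  rw [this] at h2
  have h3 : (r + (h + 1)).choose (h + 1) * (h + 1) ≤ (2 * (r + h).choose h) * (h + 1) := by
    rw [← add_assoc]; linarith
  exact Nat.le_of_mul_le_mul_right h3 (Nat.succ_pos h)

theorem pow_add_le_three_mul_pow {r z : ℕ} (hr : r ≤ z) :
    (z ^ 2 + z + 1) ^ r ≤ 3 * (z ^ 2 + 1) ^ r := by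
  have key : ((z ^ 2 + z + 1 : ℕ) : ℝ) ≤ (z ^ 2 + 1) * Real.exp (z / (z ^ 2 + 1)) := by
    have := Real.add_one_le_exp ((z : ℝ) / (z ^ 2 + 1))
    calc ((z ^ 2 + z + 1 : ℕ) : ℝ) = (z ^ 2 + 1) * (z / (z ^ 2 + 1) + 1) := by
          push_cast; field_simp; ring
      _ ≤ _ := by gcongr
  have h1 : ((z ^ 2 + z + 1 : ℕ) : ℝ) ^ r ≤ (z ^ 2 + 1) ^ r * 3 := by
    calc ((z ^ 2 + z + 1 : ℕ) : ℝ) ^ r ≤ ((z ^ 2 + 1) * Real.exp (z / (z ^ 2 + 1))) ^ r := by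
          gcongr
      _ = (z ^ 2 + 1) ^ r * Real.exp (r * (z / (z ^ 2 + 1))) := by
          rw [mul_pow, ← Real.exp_nat_mul]
      _ ≤ (z ^ 2 + 1) ^ r * Real.exp 1 := by
          gcongr
          have : (r : ℝ) ≤ z := by exact_mod_cast hr
          rw [← mul_div_assoc, div_le_one (by positivity)]
          nlinarith [(Nat.cast_nonneg z : (0 : ℝ) ≤ z)]
      _ ≤ _ := by
          gcongr
          linarith [Real.exp_one_lt_d9]
  have h2 : (((z ^ 2 + z + 1) ^ r : ℕ) : ℝ) ≤ ((3 * (z ^ 2 + 1) ^ r : ℕ) : ℝ) := by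
    push_cast at h1 ⊢; linarith
  exact_mod_cast h2

theorem card_exponentPairs (z y b h : ℕ) : (exponentPairs z y b h).card =
    (b + 1) ^ ((Finset.Icc 3 z).filter Nat.Prime).card *
      (((Finset.Ioc z y).filter Nat.Prime).card + h).choose h := by
  unfold exponentPairs
  rw [Finset.card_product, Finset.card_finsupp, Finset.card_finsuppAntidiag_nat_eq_choose,
    Finset.card_insert_of_notMem (by simp)]
  simp only [Finset.card_range, Finset.prod_const]
  congr 2
  omega

theorem card_exponentPairs_add_le {z y h : ℕ}
    (hP : ((Finset.Ioc z y).filter Nat.Prime).card ≤ h) :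
    (exponentPairs z y (z ^ 2 + z) (h + 3)).card ≤ 24 * (exponentPairs z y (z ^ 2) h).card := by
  rw [card_exponentPairs, card_exponentPairs]
  set r := ((Finset.Ioc z y).filter Nat.Prime).card
  have h1 := choose_succ_le_two_mul hP
  have h2 := choose_succ_le_two_mul (hP.trans (Nat.le_succ h))
  have h3 := choose_succ_le_two_mul (hP.trans (Nat.le_add_right h 2))
  have hr : ((Finset.Icc 3 z).filter Nat.Prime).card ≤ z := by
    refine (Finset.card_filter_le _ _).trans ?_
    simp
  have h4 := pow_add_le_three_mul_pow hr
  calc _ ≤ (3 * (z ^ 2 + 1) ^ ((Finset.Icc 3 z).filter Nat.Prime).card) *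
        (8 * (r + h).choose h) := by
        gcongr
        simp only [Nat.succ_eq_add_one, add_assoc, Nat.reduceAdd] at h1 h2 h3 ⊢
        linarith
    _ = _ := by ring

theorem eq_of_factorization_eq_of_le {A x x' : ℕ} (hx : A < x ∧ x ≤ 2 * A)
    (hx' : A < x' ∧ x' ≤ 2 * A)
    (h : ∀ p, p ≠ 2 → x.factorization p = x'.factorization p) : x = x' := by
  have key : ∀ x x' : ℕ, A < x → x' ≤ 2 * A → 0 < x' →
      (∀ p, p ≠ 2 → x.factorization p = x'.factorization p) →
      x'.factorization 2 ≤ x.factorization 2 := by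
    intro x x' hx hx' hx'0 h
    by_contra! hlt
    have hx0 : x ≠ 0 := by omega
    have : 2 * x ∣ x' := by
      rw [← Nat.factorization_le_iff_dvd (by omega) (by omega), Nat.factorization_mul (by omega) hx0,
        Nat.Prime.factorization Nat.prime_two]
      intro p
      by_cases hp : p = 2
      · subst hp; simp; omega
      · simp [Ne.symm hp, h p hp]
    have := Nat.le_of_dvd hx'0 this
    omega
  apply Nat.eq_of_factorization_eq (by omega) (by omega)
  intro p
  by_cases hp : p = 2
  · subst hp
    exact le_antisymm (key x' x hx'.1 hx.2 (by omega) fun p hp => (h p hp).symm)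
      (key x x' hx.1 hx'.2 (by omega) h)
  · exact h p hp

/-- The odd number encoded by a pair of exponent vectors. -/
noncomputable def oddValue (g : (ℕ →₀ ℕ) × (ℕ →₀ ℕ)) : ℕ :=
  (g.1 + g.2.erase 0).prod (· ^ ·)

/-- The pair of exponent vectors read off from the factorization of `x`. -/
noncomputable def exponentsOf (z y h x : ℕ) : (ℕ →₀ ℕ) × (ℕ →₀ ℕ) :=
  (x.factorization.filter (· ∈ (Finset.Icc 3 z).filter Nat.Prime),
    x.factorization.filter (· ∈ (Finset.Ioc z y).filter Nat.Prime) +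
      Finsupp.single 0 (h - ∑ p ∈ (Finset.Ioc z y).filter Nat.Prime, x.factorization p))

theorem mem_exponentPairs {z y b h : ℕ} {g : (ℕ →₀ ℕ) × (ℕ →₀ ℕ)} :
    g ∈ exponentPairs z y b h ↔
      (g.1.support ⊆ (Finset.Icc 3 z).filter Nat.Prime ∧
        ∀ p ∈ (Finset.Icc 3 z).filter Nat.Prime, g.1 p ≤ b) ∧
      (g.2 0 + ∑ p ∈ (Finset.Ioc z y).filter Nat.Prime, g.2 p = h ∧
        g.2.support ⊆ insert 0 ((Finset.Ioc z y).filter Nat.Prime)) := by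
  unfold exponentPairs
  rw [Finset.mem_product, Finset.mem_finsupp_iff, Finset.mem_finsuppAntidiag,
    Finset.sum_insert (by simp)]
  simp only [Finset.mem_range, Nat.lt_succ_iff]

theorem exponentsOf_mem {z y b h x : ℕ}
    (h1 : ∀ p ∈ (Finset.Icc 3 z).filter Nat.Prime, x.factorization p ≤ b)
    (h2 : ∑ p ∈ (Finset.Ioc z y).filter Nat.Prime, x.factorization p ≤ h) :
    exponentsOf z y h x ∈ exponentPairs z y b h := by
  have h0 : (0 : ℕ) ∉ (Finset.Ioc z y).filter Nat.Prime := by simp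
  rw [mem_exponentPairs]
  refine ⟨⟨?_, ?_⟩, ?_, ?_⟩
  · intro p hp
    by_contra hp'
    simp only [exponentsOf, Finsupp.mem_support_iff] at hp
    exact hp (Finsupp.filter_apply_neg _ _ hp')
  · intro p hp
    simp only [exponentsOf]
    rw [Finsupp.filter_apply_pos _ _ hp]
    exact h1 p hp
  · have : ∑ p ∈ (Finset.Ioc z y).filter Nat.Prime, (exponentsOf z y h x).2 p =
        ∑ p ∈ (Finset.Ioc z y).filter Nat.Prime, x.factorization p := by
      refine Finset.sum_congr rfl fun p hp => ?_
      have hp0 : p ≠ 0 := by rintro rfl; exact h0 hp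
      simp only [exponentsOf, Finsupp.add_apply]
      rw [Finsupp.filter_apply_pos _ _ hp, Finsupp.single_eq_of_ne hp0, add_zero]
    rw [this]
    simp only [exponentsOf, Finsupp.add_apply, Finsupp.single_eq_same]
    rw [Finsupp.filter_apply_neg _ _ h0]
    omega
  · intro p hp
    by_contra hp'
    rw [Finset.mem_insert, not_or] at hp'
    rw [Finsupp.mem_support_iff] at hp
    apply hp
    simp only [exponentsOf, Finsupp.add_apply]
    rw [Finsupp.filter_apply_neg _ _ hp'.2, Finsupp.single_eq_of_ne hp'.1, add_zero]

theorem factorization_eq_of_exponentsOf_eq {z y h x x' p : ℕ}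
    (hE : exponentsOf z y h x = exponentsOf z y h x') (hp : p.Prime) (hp3 : 3 ≤ p)
    (hpy : p ≤ y) : x.factorization p = x'.factorization p := by
  by_cases hpz : p ≤ z
  · have hm : p ∈ (Finset.Icc 3 z).filter Nat.Prime := by simp [*]
    have := DFunLike.congr_fun (congrArg Prod.fst hE) p
    simp only [exponentsOf] at this
    rwa [Finsupp.filter_apply_pos _ _ hm, Finsupp.filter_apply_pos _ _ hm] at this
  · have hm : p ∈ (Finset.Ioc z y).filter Nat.Prime := by
      simp only [Finset.mem_filter, Finset.mem_Ioc]; exact ⟨⟨by omega, hpy⟩, hp⟩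
    have := DFunLike.congr_fun (congrArg Prod.snd hE) p
    simp only [exponentsOf, Finsupp.add_apply] at this
    rwa [Finsupp.filter_apply_pos _ _ hm, Finsupp.filter_apply_pos _ _ hm,
      Finsupp.single_eq_of_ne hp.ne_zero, add_zero, Finsupp.single_eq_of_ne hp.ne_zero,
      add_zero] at this

section
variable {z y b h : ℕ} {g : (ℕ →₀ ℕ) × (ℕ →₀ ℕ)}

theorem support_subset_primes (hg : g ∈ exponentPairs z y b h) :
    ∀ p ∈ (g.1 + g.2.erase 0).support, p.Prime := by
  obtain ⟨⟨h1, -⟩, -, h2⟩ := mem_exponentPairs.1 hg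
  intro p hp
  rcases Finset.mem_union.1 (Finsupp.support_add hp) with hp | hp
  · exact (Finset.mem_filter.1 (h1 hp)).2
  · rw [Finsupp.support_erase, Finset.mem_erase] at hp
    rcases Finset.mem_insert.1 (h2 hp.2) with h0 | h0
    · exact absurd h0 hp.1
    · exact (Finset.mem_filter.1 h0).2

theorem oddValue_pos (hg : g ∈ exponentPairs z y b h) : 0 < oddValue g :=
  Nat.pos_of_ne_zero <| Finset.prod_ne_zero_iff.2 fun p hp =>
    pow_ne_zero _ (support_subset_primes hg p hp).ne_zero

theorem factorization_oddValue (hg : g ∈ exponentPairs z y b h) :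
    (oddValue g).factorization = g.1 + g.2.erase 0 :=
  Nat.prod_pow_factorization_eq_self (support_subset_primes hg)

theorem fst_eq_zero (hg : g ∈ exponentPairs z y b h) {p : ℕ}
    (hp : p ∉ (Finset.Icc 3 z).filter Nat.Prime) : g.1 p = 0 := by
  by_contra h0
  exact hp ((mem_exponentPairs.1 hg).1.1 (Finsupp.mem_support_iff.2 h0))

theorem snd_eq_zero (hg : g ∈ exponentPairs z y b h) {p : ℕ} (hp0 : p ≠ 0)
    (hp : p ∉ (Finset.Ioc z y).filter Nat.Prime) : g.2 p = 0 := by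
  by_contra h0
  rcases Finset.mem_insert.1 ((mem_exponentPairs.1 hg).2.2 (Finsupp.mem_support_iff.2 h0)) with h | h
  · exact hp0 h
  · exact hp h

theorem factorization_oddValue_small (hg : g ∈ exponentPairs z y b h) {p : ℕ}
    (hp : p ∈ (Finset.Icc 3 z).filter Nat.Prime) : (oddValue g).factorization p = g.1 p := by
  have hp' := Finset.mem_filter.1 hp
  have hp'' := Finset.mem_Icc.1 hp'.1
  rw [factorization_oddValue hg, Finsupp.add_apply, Finsupp.erase_ne hp'.2.ne_zero,
    snd_eq_zero hg hp'.2.ne_zero, add_zero]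
  simp only [Finset.mem_filter, Finset.mem_Ioc]
  omega

theorem factorization_oddValue_large (hg : g ∈ exponentPairs z y b h) {p : ℕ}
    (hp : p ∈ (Finset.Ioc z y).filter Nat.Prime) : (oddValue g).factorization p = g.2 p := by
  have hp' := Finset.mem_filter.1 hp
  have hp'' := Finset.mem_Ioc.1 hp'.1
  rw [factorization_oddValue hg, Finsupp.add_apply, Finsupp.erase_ne hp'.2.ne_zero,
    fst_eq_zero hg, zero_add]
  simp only [Finset.mem_filter, Finset.mem_Icc]
  omega

theorem factorization_oddValue_of_lt (hg : g ∈ exponentPairs z y b h) {p : ℕ} (hzy : z ≤ y)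
    (hp : y < p) : (oddValue g).factorization p = 0 := by
  rw [factorization_oddValue hg, Finsupp.add_apply, Finsupp.erase_ne (by omega),
    fst_eq_zero hg, snd_eq_zero hg (by omega)]
  · simp only [Finset.mem_filter, Finset.mem_Ioc]
    omega
  · simp only [Finset.mem_filter, Finset.mem_Icc]
    omega

theorem oddValue_injOn : Set.InjOn oddValue (exponentPairs z y b h : Set _) := by
  intro g hg g' hg' hgg
  have e1 : ∀ p, g.1 p = g'.1 p := fun p => by
    by_cases hp : p ∈ (Finset.Icc 3 z).filter Nat.Prime
    · rw [← factorization_oddValue_small hg hp, ← factorization_oddValue_small hg' hp, hgg]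
    · rw [fst_eq_zero hg hp, fst_eq_zero hg' hp]
  have e2 : ∀ p ∈ (Finset.Ioc z y).filter Nat.Prime, g.2 p = g'.2 p := fun p hp => by
    rw [← factorization_oddValue_large hg hp, ← factorization_oddValue_large hg' hp, hgg]
  have e3 : g.2 0 = g'.2 0 := by
    have s1 := (mem_exponentPairs.1 hg).2.1
    have s2 := (mem_exponentPairs.1 hg').2.1
    have s3 : ∑ p ∈ (Finset.Ioc z y).filter Nat.Prime, g.2 p =
        ∑ p ∈ (Finset.Ioc z y).filter Nat.Prime, g'.2 p := Finset.sum_congr rfl e2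
    omega
  refine Prod.ext (Finsupp.ext e1) (Finsupp.ext fun p => ?_)
  by_cases hp0 : p = 0
  · rw [hp0, e3]
  by_cases hp : p ∈ (Finset.Ioc z y).filter Nat.Prime
  · exact e2 p hp
  · rw [snd_eq_zero hg hp0 hp, snd_eq_zero hg' hp0 hp]

theorem oddValue_le (hg : g ∈ exponentPairs z y b h) (hy : 0 < y) :
    oddValue g ≤ (4 ^ z) ^ b * y ^ h := by
  obtain ⟨⟨h1, h2⟩, h3, h4⟩ := mem_exponentPairs.1 hg
  unfold oddValue
  rw [Finsupp.prod_add_index' (by simp) (by intros; exact pow_add _ _ _)]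
  gcongr
  · rw [Finsupp.prod_of_support_subset _ h1 _ (by simp)]
    calc ∏ p ∈ (Finset.Icc 3 z).filter Nat.Prime, p ^ g.1 p
        ≤ ∏ p ∈ (Finset.Icc 3 z).filter Nat.Prime, p ^ b := by
          refine Finset.prod_le_prod' fun p hp => ?_
          exact Nat.pow_le_pow_right (Finset.mem_filter.1 hp).2.pos (h2 p hp)
      _ = (∏ p ∈ (Finset.Icc 3 z).filter Nat.Prime, p) ^ b := Finset.prod_pow _ _ _
      _ ≤ (primorial z) ^ b := by
          gcongr
          unfold primorial
          refine Finset.prod_le_prod_of_subset_of_one_le' ?_ fun p hp _ =>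
            (Finset.mem_filter.1 hp).2.pos
          intro p
          simp only [Finset.mem_filter, Finset.mem_Icc, Finset.mem_range]
          exact fun hp => ⟨by omega, hp.2⟩
      _ ≤ (4 ^ z) ^ b := by gcongr; exact primorial_le_four_pow z
  · have hs : (g.2.erase 0).support ⊆ (Finset.Ioc z y).filter Nat.Prime := by
      intro p hp
      rw [Finsupp.support_erase, Finset.mem_erase] at hp
      exact (Finset.mem_insert.1 (h4 hp.2)).resolve_left hp.1
    rw [Finsupp.prod_of_support_subset _ hs _ (by simp)]
    calc ∏ p ∈ (Finset.Ioc z y).filter Nat.Prime, p ^ (g.2.erase 0) p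
        ≤ ∏ p ∈ (Finset.Ioc z y).filter Nat.Prime, y ^ g.2 p := by
          refine Finset.prod_le_prod' fun p hp => ?_
          rw [Finsupp.erase_ne (Finset.mem_filter.1 hp).2.ne_zero]
          exact Nat.pow_le_pow_left (Finset.mem_Ioc.1 (Finset.mem_filter.1 hp).1).2 _
      _ = y ^ ∑ p ∈ (Finset.Ioc z y).filter Nat.Prime, g.2 p := Finset.prod_pow_eq_pow_sum _ _ _
      _ ≤ y ^ h := Nat.pow_le_pow_right hy (by omega)

end

theorem sum_factorization_le_three {z y t : ℕ} (hz : 0 < z) (ht0 : t ≠ 0) (ht : t < z ^ 4) :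
    ∑ p ∈ (Finset.Ioc z y).filter Nat.Prime, t.factorization p ≤ 3 := by
  have h1 : ∏ p ∈ (Finset.Ioc z y).filter Nat.Prime, p ^ t.factorization p ≤ t := by
    conv_rhs => rw [← Nat.prod_factorization_pow_eq_self ht0]
    rw [Finsupp.prod, ← Finset.prod_filter_mul_prod_filter_not
      ((Finset.Ioc z y).filter Nat.Prime) (· ∈ t.factorization.support)]
    rw [Finset.prod_eq_one (s := Finset.filter (fun x => ¬ _) _)]
    · rw [mul_one]
      refine Finset.prod_le_prod_of_subset_of_one_le' ?_ ?_
      · intro p hp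
        exact (Finset.mem_filter.1 hp).2
      · intro p hp _
        exact Nat.pow_pos (Nat.prime_of_mem_primeFactors (by simpa using hp)).pos
    · intro p hp
      rw [Finsupp.notMem_support_iff.1 (Finset.mem_filter.1 hp).2, pow_zero]
  have h2 : z ^ (∑ p ∈ (Finset.Ioc z y).filter Nat.Prime, t.factorization p) ≤ t := by
    rw [← Finset.prod_pow_eq_pow_sum]
    refine le_trans (Finset.prod_le_prod' fun p hp => ?_) h1
    exact Nat.pow_le_pow_left (Finset.mem_Ioc.1 (Finset.mem_filter.1 hp).1).1.le _
  by_contra! hlt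
  have : z ^ 4 ≤ z ^ (∑ p ∈ (Finset.Ioc z y).filter Nat.Prime, t.factorization p) :=
    Nat.pow_le_pow_right hz hlt
  omega

theorem factorization_lt_of_lt_two_pow {z t p : ℕ} (ht0 : t ≠ 0) (ht : t < 2 ^ z) (hp : p.Prime) :
    t.factorization p < z := by
  have h1 := Nat.le_of_dvd (Nat.pos_of_ne_zero ht0) (Nat.ordProj_dvd t p)
  have h2 : 2 ^ t.factorization p ≤ p ^ t.factorization p := Nat.pow_le_pow_left hp.two_le _
  exact (Nat.pow_lt_pow_iff_right (by norm_num)).1 ((h2.trans h1).trans_lt ht)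

theorem exists_lt_f (n K z y h : ℕ) (hKy : 100 * K ≤ y) (hzy : z ≤ y) (hz : 2 ≤ z)
    (hyz : y ≤ z ^ 4) (hy2 : y ≤ 2 ^ z) (hn : (4 ^ z) ^ (z ^ 2) * y ^ h ≤ n)
    (hP : ((Finset.Ioc z y).filter Nat.Prime).card ≤ h) :
    ∃ w < 25, K * n < f n ((25 + w) * (K * n)) := by
  by_contra! hcon
  choose! a ha1 ha2 ha3 using fun w hw => exists_matching_of_f_le (hcon w hw)
  let I : (ℕ →₀ ℕ) × (ℕ →₀ ℕ) → ℕ := fun g => 2 ^ Nat.log 2 (n / oddValue g) * oddValue g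
  let G := exponentPairs z y (z ^ 2) h
  have hy : 0 < y := by omega
  have hI : ∀ g ∈ G, I g ∈ Finset.Icc 1 n ∧ n < 2 * I g := by
    intro g hg
    have h0 := oddValue_pos hg
    have hle := (oddValue_le hg hy).trans hn
    have hq : n / oddValue g ≠ 0 := (Nat.div_pos hle h0).ne'
    have h1 := Nat.pow_log_le_self 2 hq
    have h2 := Nat.lt_pow_succ_log_self (b := 2) (by norm_num) (n / oddValue g)
    rw [Nat.le_div_iff_mul_le h0] at h1
    rw [Nat.div_lt_iff_lt_mul h0, pow_succ] at h2
    refine ⟨Finset.mem_Icc.2 ⟨Nat.mul_pos (by positivity) h0, h1⟩, ?_⟩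
    simp only [I]
    linarith
  have hIfac : ∀ g ∈ G, ∀ p, p ≠ 2 → (I g).factorization p = (oddValue g).factorization p := by
    intro g hg p hp
    simp only [I]
    rw [Nat.factorization_mul (by positivity) (oddValue_pos hg).ne',
      Nat.Prime.factorization_pow Nat.prime_two, Finsupp.add_apply, Finsupp.single_eq_of_ne hp,
      zero_add]
  have hIinj : Set.InjOn I G := by
    intro g hg g' hg' hgg
    refine oddValue_injOn hg hg' (Nat.eq_of_factorization_eq (oddValue_pos hg).ne'
      (oddValue_pos hg').ne' fun p => ?_)
    by_cases hp : p = 2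
    · have h2 : ∀ g ∈ G, (oddValue g).factorization 2 = 0 := by
        intro g hg
        rw [factorization_oddValue hg, Finsupp.add_apply, Finsupp.erase_ne (by norm_num),
          fst_eq_zero hg (by simp), snd_eq_zero hg (by norm_num)]
        simp only [Finset.mem_filter, Finset.mem_Ioc]
        omega
      rw [hp, h2 g hg, h2 g' hg']
    · rw [← hIfac g hg p hp, ← hIfac g' hg' p hp, hgg]
  have hx : ∀ w < 25, ∀ g ∈ G, 25 * (K * n) < a w (I g) ∧ a w (I g) ≤ 2 * (25 * (K * n)) ∧
      ∃ t, t ≠ 0 ∧ t < y ∧ a w (I g) = I g * t := by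
    intro w hw g hg
    obtain ⟨hI1, hI2⟩ := hI g hg
    obtain ⟨h1, h2⟩ := ha2 w hw _ hI1
    have h3 : 25 * (K * n) < a w (I g) := lt_of_le_of_lt (by gcongr; omega) h1
    have h4 : a w (I g) ≤ 2 * (25 * (K * n)) := by
      have : w * (K * n) ≤ 24 * (K * n) := by gcongr; omega
      linarith
    obtain ⟨t, ht⟩ := ha1 w hw _ hI1
    refine ⟨h3, h4, t, ?_, ?_, ht⟩
    · rintro rfl
      simp only [mul_zero] at ht
      omega
    · refine lt_of_lt_of_le ?_ hKy
      have hIpos := (Finset.mem_Icc.1 hI1).1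
      by_contra! hlt
      have h5 : I g * (100 * K) ≤ a w (I g) := by rw [ht]; gcongr
      have hK : 0 < K := by
        rcases Nat.eq_zero_or_pos K with rfl | hK
        · omega
        · exact hK
      have h6 : K * n < K * (2 * I g) := Nat.mul_lt_mul_of_pos_left hI2 hK
      nlinarith
  have hmaps : ∀ q ∈ Finset.range 25 ×ˢ G,
      exponentsOf z y (h + 3) (a q.1 (I q.2)) ∈ exponentPairs z y (z ^ 2 + z) (h + 3) := by
    rintro ⟨w, g⟩ hq
    obtain ⟨hw, hg⟩ := Finset.mem_product.1 hq
    obtain ⟨-, -, t, ht0, hty, ht⟩ := hx w (Finset.mem_range.1 hw) g hg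
    have hI0 : I g ≠ 0 := (Nat.pos_of_ne_zero (by have := (hI g hg).2; omega)).ne'
    have hfac : ∀ p, p ≠ 2 → (a w (I g)).factorization p =
        (oddValue g).factorization p + t.factorization p := fun p hp => by
      rw [ht, Nat.factorization_mul hI0 ht0, Finsupp.add_apply, hIfac g hg p hp]
    apply exponentsOf_mem
    · intro p hp
      have hp' := Finset.mem_filter.1 hp
      have hp'' := Finset.mem_Icc.1 hp'.1
      simp only
      rw [hfac p (by omega), factorization_oddValue_small hg hp]
      have := (mem_exponentPairs.1 hg).1.2 p hp
      have := factorization_lt_of_lt_two_pow ht0 (hty.trans_le hy2) hp'.2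
      omega
    · have e : ∑ p ∈ (Finset.Ioc z y).filter Nat.Prime, (a w (I g)).factorization p =
          ∑ p ∈ (Finset.Ioc z y).filter Nat.Prime, (g.2 p + t.factorization p) := by
        refine Finset.sum_congr rfl fun p hp => ?_
        have hp'' := Finset.mem_Ioc.1 (Finset.mem_filter.1 hp).1
        rw [hfac p (by omega), factorization_oddValue_large hg hp]
      simp only
      rw [e, Finset.sum_add_distrib]
      have := sum_factorization_le_three (y := y) (by omega) ht0 (hty.trans_le hyz)
      have h5 : g.2 0 + ∑ p ∈ (Finset.Ioc z y).filter Nat.Prime, g.2 p = h :=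
        (mem_exponentPairs.1 hg).2.1
      omega
  have hinj : Set.InjOn (fun q : ℕ × ((ℕ →₀ ℕ) × (ℕ →₀ ℕ)) =>
      exponentsOf z y (h + 3) (a q.1 (I q.2))) (Finset.range 25 ×ˢ G : Finset _) := by
    rintro ⟨w, g⟩ hq ⟨w', g'⟩ hq' hE
    obtain ⟨hw, hg⟩ := Finset.mem_product.1 (Finset.mem_coe.1 hq)
    obtain ⟨hw', hg'⟩ := Finset.mem_product.1 (Finset.mem_coe.1 hq')
    simp only [Finset.mem_range] at hw hw' hg hg' hE
    obtain ⟨hx1, hx2, t, ht0, hty, ht⟩ := hx w hw g hg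
    obtain ⟨hx1', hx2', t', ht0', hty', ht'⟩ := hx w' hw' g' hg'
    have large : ∀ w g t, g ∈ G → t ≠ 0 → t < y → a w (I g) = I g * t → ∀ p, y < p → p ≠ 2 →
        (a w (I g)).factorization p = 0 := by
      intro w g t hg ht0 hty ht p hp hp2
      have hI0 : I g ≠ 0 := by have := (hI g hg).2; omega
      rw [ht, Nat.factorization_mul hI0 ht0, Finsupp.add_apply, hIfac g hg p hp2,
        factorization_oddValue_of_lt hg hzy hp, Nat.factorization_eq_zero_of_lt (by omega)]
    have hxx : a w (I g) = a w' (I g') := by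
      refine eq_of_factorization_eq_of_le ⟨hx1, hx2⟩ ⟨hx1', hx2'⟩ fun p hp2 => ?_
      by_cases hp : p.Prime
      · have := hp.two_le
        by_cases hpy : p ≤ y
        · exact factorization_eq_of_exponentsOf_eq hE hp (by omega) hpy
        · rw [large w g t hg ht0 hty ht p (by omega) hp2,
            large w' g' t' hg' ht0' hty' ht' p (by omega) hp2]
      · rw [Nat.factorization_eq_zero_of_not_prime _ hp, Nat.factorization_eq_zero_of_not_prime _ hp]
    have hww : w = w' := by
      have b1 := ha2 w hw _ (hI g hg).1
      have b2 := ha2 w' hw' _ (hI g' hg').1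
      rw [hxx] at b1
      have c1 : (25 + w) * (K * n) < (25 + w' + 1) * (K * n) := by linarith
      have c2 : (25 + w') * (K * n) < (25 + w + 1) * (K * n) := by linarith
      have c3 := lt_of_mul_lt_mul_right c1 (Nat.zero_le _)
      have c4 := lt_of_mul_lt_mul_right c2 (Nat.zero_le _)
      omega
    subst hww
    have := hIinj hg hg' (ha3 w hw (hI g hg).1 (hI g' hg').1 hxx)
    rw [this]
  have hcard := Finset.card_le_card_of_injOn _ hmaps hinj
  rw [Finset.card_product, Finset.card_range] at hcard
  have hle := card_exponentPairs_add_le hP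
  have hpos : 0 < G.card := by
    simp only [G]
    rw [card_exponentPairs]
    exact Nat.mul_pos (by positivity) (Nat.choose_pos (by omega))
  have : 25 * G.card ≤ 24 * G.card := hcard.trans hle
  omega

theorem pow_four_le_two_pow {z : ℕ} (hz : 16 ≤ z) : z ^ 4 ≤ 2 ^ z := by
  induction z, hz using Nat.le_induction with
  | base => norm_num
  | succ z hz ih =>
    have : (z + 1) ^ 4 ≤ 2 * z ^ 4 := by
      have h1 : 16 * z ^ 3 ≤ z * z ^ 3 := by gcongr
      have h2 : z ^ 2 ≤ z ^ 3 := Nat.pow_le_pow_right (by omega) (by norm_num)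
      have h3 : z ≤ z ^ 3 := Nat.le_self_pow (by norm_num) z
      have h4 : 1 ≤ z ^ 3 := Nat.one_le_pow _ _ (by omega)
      nlinarith
    rw [pow_succ 2 z]
    linarith

theorem card_primes_Ioc_le_primeCounting (z y : ℕ) :
    ((Finset.Ioc z y).filter Nat.Prime).card ≤ Nat.primeCounting y := by
  rw [← Nat.primesLE_card_eq_primeCounting]
  apply Finset.card_le_card
  intro p hp
  rw [Finset.mem_filter, Finset.mem_Ioc] at hp
  exact Nat.mem_primesLE.2 ⟨hp.1.2, hp.2⟩

/-- The quantitative form of the theorem, in terms of the fourth root `r` of `log n`. -/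
theorem exists_f_sub_f_self_gt {n : ℕ} {r : ℝ} (hn : 0 < n) (hr : 100 ≤ r)
    (hnr : Real.log n = r ^ 4) (hL : 100 ≤ Real.log (r ^ 4)) (hLr : Real.log (r ^ 4) ≤ r)
    (hpi : (Nat.primeCounting (100 * ⌊r ^ 4 / Real.log (r ^ 4)⌋₊) : ℝ) ≤
      r ^ 4 / Real.log (r ^ 4) / 4) :
    ∃ m : ℕ, 0 < m ∧
      (f n m : ℝ) - (f n n : ℝ) > 0.36 * n * Real.log n / Real.log (Real.log n) := by
  rw [hnr]
  set L := Real.log (r ^ 4) with hLdef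
  set q := r ^ 4 / L with hq
  have hn' : (0 : ℝ) < n := by exact_mod_cast hn
  have hqL : q * L = r ^ 4 := by rw [hq]; field_simp
  have hqr : r ^ 3 ≤ q := by
    rw [hq, le_div_iff₀ (by linarith)]
    calc r ^ 3 * L ≤ r ^ 3 * r := by gcongr
      _ = r ^ 4 := by ring
  have hr3 : 100 * r ^ 2 ≤ r ^ 3 := by nlinarith [sq_nonneg r]
  have hr2 : 100 * r ≤ r ^ 2 := by nlinarith
  have hq0 : 0 ≤ q := by linarith
  have hK1 : (⌊q⌋₊ : ℝ) ≤ q := Nat.floor_le hq0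
  have hK2 : q < ⌊q⌋₊ + 1 := Nat.lt_floor_add_one q
  set K := ⌊q⌋₊
  have hz1 : (⌊r⌋₊ : ℝ) ≤ r := Nat.floor_le (by linarith)
  have hz2 : r < (⌊r⌋₊ + 1 : ℕ) := by push_cast; exact Nat.lt_floor_add_one r
  have hz3 : ((⌊r⌋₊ + 1 : ℕ) : ℝ) ≤ r + 1 := by push_cast; linarith
  set z := ⌊r⌋₊ + 1
  have hh1 : (⌊q / 2⌋₊ : ℝ) ≤ q / 2 := Nat.floor_le (by linarith)
  have hh2 : q / 2 < ⌊q / 2⌋₊ + 1 := Nat.lt_floor_add_one _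
  set h := ⌊q / 2⌋₊
  have hu1 : r ^ 2 ≤ (⌈r ^ 2⌉₊ : ℝ) := Nat.le_ceil _
  have hu2 : (⌈r ^ 2⌉₊ : ℝ) < r ^ 2 + 1 := Nat.ceil_lt_add_one (by positivity)
  set u := ⌈r ^ 2⌉₊
  have hz16 : 16 ≤ z := by
    have : (16 : ℝ) ≤ z := by linarith
    exact_mod_cast this
  have hK0 : 0 < K := by
    have : (0 : ℝ) < K := by linarith
    exact_mod_cast this
  have hyr : ((100 * K : ℕ) : ℝ) ≤ r ^ 4 := by
    push_cast
    nlinarith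
  have hzy : z ≤ 100 * K := by
    have : (z : ℝ) ≤ ((100 * K : ℕ) : ℝ) := by push_cast; linarith
    exact_mod_cast this
  have hyz : 100 * K ≤ z ^ 4 := by
    have : ((100 * K : ℕ) : ℝ) ≤ ((z ^ 4 : ℕ) : ℝ) := by
      refine hyr.trans ?_
      push_cast
      gcongr
    exact_mod_cast this
  have hnn : (4 ^ z) ^ (z ^ 2) * (100 * K) ^ h ≤ n := by
    have hlog : Real.log (((4 ^ z) ^ (z ^ 2) * (100 * K) ^ h : ℕ) : ℝ) ≤ Real.log n := by
      rw [hnr]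
      push_cast
      rw [Real.log_mul (by positivity) (by positivity), Real.log_pow, Real.log_pow, Real.log_pow]
      have hlog4 : Real.log 4 ≤ 1.4 := by
        rw [show (4 : ℝ) = 2 ^ 2 by norm_num, Real.log_pow]
        have := Real.log_two_lt_d9
        push_cast
        linarith
      have h1 : ((z ^ 2 : ℕ) : ℝ) * (z * Real.log 4) ≤ r ^ 4 / 2 := by
        calc ((z ^ 2 : ℕ) : ℝ) * (z * Real.log 4) = (z : ℝ) ^ 3 * Real.log 4 := by
              push_cast; ring
          _ ≤ (2 * r) ^ 3 * 1.4 := by gcongr; linarith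
          _ ≤ r ^ 4 / 2 := by nlinarith [pow_pos (show 0 < r by linarith) 3]
      have h2 : (h : ℝ) * Real.log (100 * K) ≤ r ^ 4 / 2 := by
        calc (h : ℝ) * Real.log (100 * K) ≤ q / 2 * L := by
              refine mul_le_mul hh1 ?_ (Real.log_nonneg (by norm_cast; omega)) (by linarith)
              rw [hLdef]
              push_cast at hyr
              exact Real.log_le_log (by positivity) hyr
          _ = r ^ 4 / 2 := by rw [← hqL]; ring
      linarith
    have hpos : (0 : ℝ) < (((4 ^ z) ^ (z ^ 2) * (100 * K) ^ h : ℕ) : ℝ) := by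
      push_cast; positivity
    exact_mod_cast (Real.log_le_log_iff hpos hn').1 hlog
  have hP : ((Finset.Ioc z (100 * K)).filter Nat.Prime).card ≤ h := by
    refine (card_primes_Ioc_le_primeCounting _ _).trans ?_
    have : (Nat.primeCounting (100 * K) : ℝ) ≤ h := by linarith
    exact_mod_cast this
  obtain ⟨w, -, hw⟩ := exists_lt_f n K z (100 * K) h le_rfl hzy (by omega) hyz
    (hyz.trans (pow_four_le_two_pow hz16)) hnn hP
  have hu0 : (0 : ℝ) < u := by linarith
  have hu := f_self_le n u (by exact_mod_cast hu0) (by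
    rw [Real.log_mul (by positivity) (by positivity), Real.log_mul (by positivity) (by positivity),
      hnr]
    have h1 : Real.log 32 ≤ 5 := by
      rw [show (32 : ℝ) = 2 ^ 5 by norm_num, Real.log_pow]
      have := Real.log_two_lt_d9
      push_cast
      linarith
    have h2 := Real.log_le_sub_one_of_pos hu0
    have h3 : (r ^ 2) ^ 2 ≤ (u : ℝ) ^ 2 := by gcongr
    nlinarith)
  refine ⟨(25 + w) * (K * n), by positivity, ?_⟩
  have hw' : (K : ℝ) * n < f n ((25 + w) * (K * n)) := by exact_mod_cast hw
  have hu' : (f n n : ℝ) ≤ 32 * u * n := by exact_mod_cast hu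
  have e : 0.36 * (n : ℝ) * r ^ 4 / L = 0.36 * q * n := by rw [hq]; ring
  have hmain : 0.36 * q * n + 32 * u * n ≤ K * n := by
    rw [← add_mul]
    gcongr
    linarith
  rw [e]
  linarith

theorem eventually_primeCounting_le_div_four :
    ∀ᶠ q : ℝ in Filter.atTop, (Nat.primeCounting (100 * ⌊q⌋₊) : ℝ) ≤ q / 4 := by
  have hlim : Filter.Tendsto (fun q : ℝ => ((100 * ⌊q⌋₊ : ℕ) : ℝ)) Filter.atTop Filter.atTop :=
    tendsto_natCast_atTop_atTop.comp
      (tendsto_nat_floor_atTop.const_mul_atTop' (by norm_num))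
  filter_upwards [hlim.eventually (Chebyshev.eventually_primeCounting_le (ε := 0.1) (by norm_num)),
    (Real.tendsto_log_atTop.comp hlim).eventually_ge_atTop 600,
    Filter.eventually_ge_atTop 0] with q h1 h2 h3
  rw [Nat.floor_natCast] at h1
  simp only [Function.comp_apply] at h2
  refine h1.trans ?_
  rw [div_le_iff₀ (by linarith)]
  have hlog4 : Real.log 4 ≤ 1.4 := by
    rw [show (4 : ℝ) = 2 ^ 2 by norm_num, Real.log_pow]
    have := Real.log_two_lt_d9
    push_cast
    linarith
  have := Nat.floor_le h3
  calc (Real.log 4 + 0.1) * ((100 * ⌊q⌋₊ : ℕ) : ℝ) ≤ 1.5 * (100 * q) := by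
        push_cast
        gcongr
        linarith
    _ = q / 4 * 600 := by ring
    _ ≤ _ := by gcongr

theorem stmt_0 : ∃ N : ℕ, ∀ n : ℕ, N ≤ n → 0 < n →
    ∃ m : ℕ, 0 < m ∧
      (f n m : ℝ) - (f n n : ℝ) > 0.36 * n * Real.log n / Real.log (Real.log n) := by
  have hlog : ∀ᶠ r : ℝ in Filter.atTop, Real.log (r ^ 4) ≤ r := by
    filter_upwards [Real.isLittleO_log_id_atTop.bound (show (0 : ℝ) < 1 / 4 by norm_num),
      Filter.eventually_ge_atTop 0] with r h hr
    rw [Real.norm_eq_abs, Real.norm_eq_abs, id, abs_of_nonneg hr] at h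
    rw [Real.log_pow]
    push_cast
    linarith [le_abs_self (Real.log r)]
  have hpow : Filter.Tendsto (fun r : ℝ => r ^ 4) Filter.atTop Filter.atTop :=
    Filter.tendsto_pow_atTop (by norm_num)
  have hq : Filter.Tendsto (fun r : ℝ => r ^ 4 / Real.log (r ^ 4)) Filter.atTop Filter.atTop := by
    refine Filter.tendsto_atTop_mono' _ ?_ (Filter.tendsto_pow_atTop (α := ℝ) (n := 3) (by norm_num))
    filter_upwards [hlog, Filter.eventually_gt_atTop 1] with r h hr
    rw [le_div_iff₀ (Real.log_pos (one_lt_pow₀ hr (by norm_num)))]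
    calc r ^ 3 * Real.log (r ^ 4) ≤ r ^ 3 * r := by gcongr
      _ = r ^ 4 := by ring
  have hroot : Filter.Tendsto (fun n : ℕ => Real.log n ^ (1 / 4 : ℝ)) Filter.atTop Filter.atTop :=
    (tendsto_rpow_atTop (by norm_num)).comp
      (Real.tendsto_log_atTop.comp tendsto_natCast_atTop_atTop)
  have hall := hroot.eventually (hlog.and ((Filter.eventually_ge_atTop 100).and
    (((Real.tendsto_log_atTop.comp hpow).eventually_ge_atTop 100).and
      (hq.eventually eventually_primeCounting_le_div_four))))
  obtain ⟨N, hN⟩ := Filter.eventually_atTop.1 hall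
  refine ⟨N, fun n hNn hn => ?_⟩
  obtain ⟨h1, h2, h3, h4⟩ := hN n hNn
  refine exists_f_sub_f_self_gt hn h2 ?_ h3 h1 h4
  rw [← Real.rpow_natCast, ← Real.rpow_mul (Real.log_natCast_nonneg n)]
  norm_num
end

section
/- For all sufficiently large positive integers n, there exists a positive integer m such that f(n, m) > 0.36 · n · log n / log log n; that is, there exists an interval of length at least 0.36 · n · log n / log log n that does not contain distinct multiples of 1, 2, ..., n. (Here log denotes the natural logarithm.) -/
open Real

theorem exists_f_witness (n m : ℕ) : ∃ a : ℕ → ℕ,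
    (∀ i ∈ Finset.Icc 1 n, i ∣ a i) ∧
    (∀ i ∈ Finset.Icc 1 n, m < a i ∧ a i ≤ m + f n m) ∧
    Set.InjOn a (Finset.Icc 1 n) := by
  have hne : {L : ℕ | ∃ a : ℕ → ℕ,
    (∀ i ∈ Finset.Icc 1 n, i ∣ a i) ∧
    (∀ i ∈ Finset.Icc 1 n, m < a i ∧ a i ≤ m + L) ∧
    Set.InjOn a (Finset.Icc 1 n)}.Nonempty := by
    refine ⟨n * (m + 1), fun i => i * (m + 1), fun i _ => dvd_mul_right _ _, fun i hi => ?_, ?_⟩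
    · rw [Finset.mem_Icc] at hi
      constructor
      · nlinarith
      · nlinarith
    · intro i _ j _ hij
      exact Nat.eq_of_mul_eq_mul_right (Nat.succ_pos m) hij
  exact Nat.sInf_mem hne

theorem exists_digits {R K t : ℕ} (ht : t < R ^ K) :
    ∃ d : Fin K → Fin R, t = ∑ i : Fin K, (d i : ℕ) * R ^ (i : ℕ) := by
  refine ⟨finFunctionFinEquiv.symm ⟨t, ht⟩, ?_⟩
  rw [← finFunctionFinEquiv_apply, Equiv.apply_symm_apply]

/-- Assigning to `t = ∑ d i * R ^ i` the intercept `C - ∑ i * d i * R ^ i`, the line of slope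
`t` does not depend, at height `j`, on the digit `d j`; hence few points are covered in total. -/
theorem exists_intercepts (R K A C : ℕ) (hC : K * R ^ K ≤ C) :
    ∃ (Q : Finset ℤ) (z : ℕ → ℤ), Q.card ≤ K * R ^ (K - 1) ∧
      (∀ t < R ^ K, 0 ≤ z t ∧ z t ≤ C) ∧
      ∀ t < R ^ K, ∀ j < K, z t + (j : ℤ) * (A + t) ∈ Q := by
  classical
  let g : (Σ j : Fin K, ({i : Fin K // i ≠ j} → Fin R)) → ℤ := fun s =>
    C + (s.1 : ℕ) * A + ∑ i : {i : Fin K // i ≠ s.1},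
      (((s.1 : ℕ) : ℤ) - ((i : Fin K) : ℕ)) * ((s.2 i : ℕ) * (R : ℤ) ^ ((i : Fin K) : ℕ))
  choose d hd using fun t (ht : t < R ^ K) => exists_digits ht
  let z : ℕ → ℤ := fun t =>
    if ht : t < R ^ K then
      C - ∑ i : Fin K, ((i : ℕ) : ℤ) * ((d t ht i : ℕ) * (R : ℤ) ^ (i : ℕ)) else 0
  refine ⟨Finset.univ.image g, z, ?_, ?_, ?_⟩
  · refine Finset.card_image_le.trans ?_
    rw [Finset.card_univ, Fintype.card_sigma]
    simp
  · intro t ht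
    have hsum : (t : ℤ) = ∑ i : Fin K, ((d t ht i : ℕ) : ℤ) * (R : ℤ) ^ (i : ℕ) := by
      exact_mod_cast hd t ht
    have h1 : ∑ i : Fin K, ((i : ℕ) : ℤ) * ((d t ht i : ℕ) * (R : ℤ) ^ (i : ℕ)) ≤ K * t := by
      rw [hsum, Finset.mul_sum]
      refine Finset.sum_le_sum fun i _ => ?_
      have : ((i : ℕ) : ℤ) ≤ K := by exact_mod_cast i.2.le
      gcongr
    have h2 : (K : ℤ) * t ≤ C := by
      have : K * t ≤ C := (Nat.mul_le_mul_left K ht.le).trans hC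
      exact_mod_cast this
    have h3 : 0 ≤ ∑ i : Fin K, ((i : ℕ) : ℤ) * ((d t ht i : ℕ) * (R : ℤ) ^ (i : ℕ)) :=
      Finset.sum_nonneg fun i _ => by positivity
    simp only [z, dif_pos ht]
    constructor <;> linarith
  · intro t ht j hj
    have hsum : (t : ℤ) = ∑ i : Fin K, ((d t ht i : ℕ) : ℤ) * (R : ℤ) ^ (i : ℕ) := by
      exact_mod_cast hd t ht
    refine Finset.mem_image.2 ⟨⟨⟨j, hj⟩, fun i => d t ht i⟩, Finset.mem_univ _, ?_⟩
    have hsub : ∑ i : {i : Fin K // i ≠ ⟨j, hj⟩},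
        ((j : ℤ) - ((i : Fin K) : ℕ)) * ((d t ht i : ℕ) * (R : ℤ) ^ ((i : Fin K) : ℕ)) =
        ∑ i : Fin K, ((j : ℤ) - (i : ℕ)) * ((d t ht i : ℕ) * (R : ℤ) ^ (i : ℕ)) := by
      rw [← Finset.sum_subtype (Finset.univ.erase (⟨j, hj⟩ : Fin K)) (by simp)
        (fun i : Fin K => ((j : ℤ) - (i : ℕ)) * ((d t ht i : ℕ) * (R : ℤ) ^ (i : ℕ)))]
      exact Finset.sum_erase _ (by simp)
    simp only [g, z, dif_pos ht]
    rw [hsub]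
    simp only [sub_mul, Finset.sum_sub_distrib]
    rw [← Finset.mul_sum, ← hsum]
    ring

theorem exists_f_ge_of_primes {n R K A b : ℕ} (P : Finset ℕ) (hK : 0 < K)
    (hP : ∀ p ∈ P, p.Prime ∧ A ≤ p ∧ p < A + R ^ K) (hA : K * R ^ K ≤ A) (hb : 0 < b)
    (hbn : b * (A + R ^ K) ≤ n) (hcard : K * R ^ (K - 1) < P.card) :
    ∃ m : ℕ, 0 < m ∧ K * A * b ≤ f n m := by
  classical
  obtain ⟨Q, z, hQ, hz, hzQ⟩ := exists_intercepts R K A A hA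
  have hcop : Set.Pairwise (P : Set ℕ) (Function.onFun Nat.Coprime (fun p : ℕ => p)) := by
    intro p hp q hq hpq
    exact (Nat.coprime_primes (hP p hp).1 (hP q hq).1).2 hpq
  obtain ⟨m₀, hm₀⟩ := Nat.chineseRemainderOfFinset
    (fun p : ℕ => ((-z (p - A)) % (p : ℤ)).toNat) (fun p : ℕ => p) P
    (fun p hp => (hP p hp).1.ne_zero) hcop
  let m' := m₀ + ∏ p ∈ P, p
  have hm'pos : 0 < m' := by
    have : 0 < ∏ p ∈ P, p := Finset.prod_pos fun p hp => (hP p hp).1.pos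
    omega
  have hm' : ∀ p ∈ P, (p : ℤ) ∣ m' + z (p - A) := by
    intro p hp
    have hp0 : (p : ℤ) ≠ 0 := by exact_mod_cast (hP p hp).1.ne_zero
    have h1 := (Nat.modEq_iff_dvd.1 (hm₀ p hp))
    have h2 : ((((-z (p - A)) % (p : ℤ)).toNat : ℕ) : ℤ) = (-z (p - A)) % (p : ℤ) :=
      Int.toNat_of_nonneg (Int.emod_nonneg _ hp0)
    rw [h2] at h1
    have h3 : (p : ℤ) ∣ (-z (p - A)) - (-z (p - A)) % (p : ℤ) := Int.dvd_self_sub_emod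
    have h4 : (p : ℤ) ∣ ((∏ p ∈ P, p : ℕ) : ℤ) := by
      exact_mod_cast Finset.dvd_prod_of_mem _ hp
    have h5 := dvd_sub (dvd_sub h4 h1) h3
    have h6 : (m' : ℤ) = m₀ + ((∏ p ∈ P, p : ℕ) : ℤ) := Nat.cast_add _ _
    rw [h6]
    refine h5.trans (dvd_of_eq ?_)
    ring
  refine ⟨b * m', Nat.mul_pos hb hm'pos, ?_⟩
  by_contra! hlt
  obtain ⟨a, ha, haI, hinj⟩ := exists_f_witness n (b * m')
  set L := f n (b * m') with hL
  have hmem : ∀ p ∈ P, b * p ∈ Finset.Icc 1 n := by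
    intro p hp
    obtain ⟨h1, h2, h3⟩ := hP p hp
    rw [Finset.mem_Icc]
    exact ⟨Nat.mul_pos hb h1.pos, (Nat.mul_le_mul_left b h3.le).trans hbn⟩
  have hmaps : ∀ p ∈ P, (a (b * p) : ℤ) / b - m' ∈ Q := by
    intro p hp
    obtain ⟨h1, h2, h3⟩ := hP p hp
    obtain ⟨c, hc⟩ := ha _ (hmem p hp)
    obtain ⟨hlo, hhi⟩ := haI _ (hmem p hp)
    have hb' : (0 : ℤ) < b := by exact_mod_cast hb
    have hdiv : (a (b * p) : ℤ) / b = p * c := by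
      rw [hc]
      push_cast
      rw [mul_assoc]
      exact Int.mul_ediv_cancel_left _ hb'.ne'
    have hpc : m' < p * c := by
      rw [hc, mul_assoc] at hlo
      exact lt_of_mul_lt_mul_left hlo (Nat.zero_le b)
    have hpc2 : p * c < m' + K * A := by
      rw [hc, mul_assoc] at hhi
      have : b * (p * c) < b * (m' + K * A) := by
        calc b * (p * c) ≤ b * m' + L := hhi
          _ < b * m' + K * A * b := by omega
          _ = _ := by ring
      exact lt_of_mul_lt_mul_left this (Nat.zero_le b)
    have ht : p - A < R ^ K := by omega
    obtain ⟨hz0, hzA⟩ := hz _ ht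
    obtain ⟨e, he⟩ := hm' p hp
    have hpc' : (m' : ℤ) < p * c := by exact_mod_cast hpc
    have hpc2' : (p * c : ℤ) < m' + K * A := by exact_mod_cast hpc2
    have hAp : (A : ℤ) ≤ p := by exact_mod_cast h2
    have hp0 : (0 : ℤ) < p := by exact_mod_cast h1.pos
    have hj0 : 0 ≤ (c : ℤ) - e := by
      by_contra! hneg
      have : (c : ℤ) - e ≤ -1 := by omega
      nlinarith
    have hjK : (c : ℤ) - e < K := by
      by_contra! hneg
      have hK0 : (0 : ℤ) ≤ K := by positivity
      nlinarith
    obtain ⟨j, hj⟩ := Int.eq_ofNat_of_zero_le hj0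
    have := hzQ _ ht j (by omega)
    rw [← hj] at this
    have hcast : (A : ℤ) + ((p - A : ℕ) : ℤ) = p := by omega
    rw [hcast] at this
    rw [hdiv]
    convert this using 1
    linarith
  obtain ⟨p, hp, q, hq, hpq, heq⟩ :=
    Finset.exists_ne_map_eq_of_card_lt_of_maps_to (hQ.trans_lt hcard) hmaps
  have hba : ∀ p ∈ P, (b : ℤ) ∣ a (b * p) := fun p hp => by
    exact_mod_cast (dvd_mul_right b p).trans (ha _ (hmem p hp))
  have h1 : (a (b * p) : ℤ) / b = a (b * q) / b := by linarith
  have h2 : (a (b * p) : ℤ) = a (b * q) := by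
    rw [← Int.ediv_mul_cancel (hba p hp), h1, Int.ediv_mul_cancel (hba q hq)]
  have h3 := hinj (hmem p hp) (hmem q hq) (by exact_mod_cast h2)
  exact hpq (Nat.eq_of_mul_eq_mul_left hb h3)

theorem exists_block_of_primeCounting {x H K T : ℕ} (hH : 0 < H)
    (h : K * H + (x / H + 1) * T < Nat.primeCounting x) :
    ∃ i, K ≤ i ∧ i * H ≤ x ∧
      T < ((Finset.Ico (i * H) (i * H + H)).filter Nat.Prime).card := by
  classical
  let S := (Finset.range (x + 1)).filter Nat.Prime
  let S' := S.filter (fun p => K * H ≤ p)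
  have hS : S.card = Nat.primeCounting x := by
    simp [S, Nat.primeCounting, Nat.primeCounting', Nat.count_eq_card_filter_range]
  have hsplit : S.card ≤ S'.card + K * H := by
    rw [← Finset.card_filter_add_card_filter_not (s := S) (fun p => K * H ≤ p)]
    refine Nat.add_le_add_left ?_ _
    refine (Finset.card_le_card (t := Finset.range (K * H)) ?_).trans (by simp)
    intro p hp
    simp only [Finset.mem_filter, not_le] at hp
    simpa using hp.2
  obtain ⟨i, hi, hcard⟩ := Finset.exists_lt_card_fiber_of_mul_lt_card_of_maps_to
    (s := S') (t := Finset.range (x / H + 1)) (f := fun p => p / H) (n := T)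
    (fun p hp => by
      simp only [S', S, Finset.mem_filter, Finset.mem_range] at hp ⊢
      have : p / H ≤ x / H := Nat.div_le_div_right (by omega)
      omega)
    (by rw [Finset.card_range]; omega)
  refine ⟨i, ?_, ?_, hcard.trans_le (Finset.card_le_card ?_)⟩
  · obtain ⟨p, hp⟩ := Finset.card_pos.1 (Nat.zero_lt_of_lt hcard)
    simp only [S', S, Finset.mem_filter] at hp
    rw [← hp.2]
    exact (Nat.le_div_iff_mul_le hH).2 hp.1.2
  · rw [Finset.mem_range] at hi
    exact (Nat.le_div_iff_mul_le hH).1 (by omega)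
  · intro p hp
    simp only [S', S, Finset.mem_filter, Finset.mem_Ico] at hp ⊢
    have h1 := Nat.div_add_mod p H
    have h2 := Nat.mod_lt p hH
    rw [hp.2, mul_comm] at h1
    exact ⟨⟨by omega, by omega⟩, hp.1.1.2⟩

theorem half_mul_div_log_le_primeCounting {x : ℕ} (hx : 2000 ≤ x) :
    (x : ℝ) / 2 / Real.log x ≤ Nat.primeCounting x := by
  refine le_trans ?_ (Chebyshev.pi_ge x)
  have hx' : (2000 : ℝ) ≤ x := by exact_mod_cast hx
  have hlog : 0 < Real.log x := Real.log_pos (by linarith)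
  have h1 : Real.log ((x : ℝ) + 1) = Real.log (((x : ℝ) + 1) / 100) + Real.log 100 := by
    rw [← Real.log_mul (by positivity) (by norm_num)]
    congr 1
    ring
  have h2 := Real.log_le_sub_one_of_pos (show (0 : ℝ) < ((x : ℝ) + 1) / 100 by positivity)
  have h3 := Real.log_le_sub_one_of_pos (show (0 : ℝ) < 100 by norm_num)
  have h4 := Real.log_two_gt_d9
  gcongr
  nlinarith

theorem exists_f_ge {n R K : ℕ} (hR : 0 < R) (hK : 100 ≤ K) (hH : R ^ K ≤ n / 200)
    (h : K * R ^ K + (n / 200 / R ^ K + 1) * (K * R ^ (K - 1)) < Nat.primeCounting (n / 200)) :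
    ∃ m : ℕ, 0 < m ∧ 0.98 * (K : ℝ) * n ≤ f n m := by
  have hHpos : 0 < R ^ K := pow_pos hR K
  obtain ⟨i, hKi, hix, hcard⟩ := exists_block_of_primeCounting hHpos h
  set H := R ^ K with hHdef
  set A := i * H with hAdef
  have hKA : K * H ≤ A := Nat.mul_le_mul_right H hKi
  have hsmall : 100 * (A + H) ≤ n := by omega
  have hpos : 0 < A + H := by omega
  obtain ⟨m, hm, hf⟩ := exists_f_ge_of_primes (n := n) (R := R) (K := K) (A := A)
    (b := n / (A + H)) _ (by omega)
    (fun p hp => by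
      simp only [Finset.mem_filter, Finset.mem_Ico] at hp
      exact ⟨hp.2, hp.1.1, hp.1.2⟩) hKA
    (Nat.div_pos (by omega) hpos) (Nat.div_mul_le_self n (A + H)) hcard
  refine ⟨m, hm, ?_⟩
  set b := n / (A + H) with hbdef
  have hb : n < (A + H) * (b + 1) := Nat.lt_mul_div_succ n hpos
  have hb' : (n : ℝ) < (A + H) * (b + 1) := by exact_mod_cast hb
  have hsmall' : (100 : ℝ) * (A + H) ≤ n := by exact_mod_cast hsmall
  have h100 : 100 * H ≤ A := (Nat.mul_le_mul_right H hK).trans hKA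
  have h100' : (100 : ℝ) * H ≤ A := by exact_mod_cast h100
  have hf' : (K : ℝ) * A * b ≤ f n m := by exact_mod_cast hf
  refine le_trans ?_ hf'
  have hb0 : (0 : ℝ) ≤ b := by positivity
  have h1 : 0.99 * (n : ℝ) ≤ (A + H) * b := by linarith
  have h2 : 100 / 101 * ((A : ℝ) + H) ≤ A := by linarith
  have h3 : 0.98 * (n : ℝ) ≤ A * b := by
    have := mul_le_mul_of_nonneg_right h2 hb0
    have hn : (0 : ℝ) ≤ n := by positivity
    linarith
  have hK0 : (0 : ℝ) ≤ K := by positivity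
  nlinarith

theorem eventually_parameters : ∀ᶠ l : ℝ in Filter.atTop, 10 ^ 6 ≤ l ∧
    100 * Real.log l ≤ 0.38 * l ∧ 10 ^ 5 * l ^ 5 < Real.exp (0.05 * l) := by
  refine (Filter.eventually_ge_atTop _).and (Filter.Eventually.and ?_ ?_)
  · have := Real.isLittleO_log_id_atTop.bound (show (0 : ℝ) < 0.0038 by norm_num)
    filter_upwards [this, Filter.eventually_ge_atTop 1] with l hl h1
    rw [Real.norm_of_nonneg (Real.log_nonneg h1), id, Real.norm_of_nonneg (by linarith)] at hl
    linarith
  · have := (isLittleO_pow_exp_pos_mul_atTop 5 (show (0 : ℝ) < 0.05 by norm_num)).bound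
      (show (0 : ℝ) < 1 / 10 ^ 6 by norm_num)
    filter_upwards [this, Filter.eventually_ge_atTop 1] with l hl h1
    rw [Real.norm_of_nonneg (by positivity), Real.norm_of_nonneg (by positivity)] at hl
    have := Real.exp_pos (0.05 * l)
    linarith

theorem stmt_1 : ∃ N : ℕ, ∀ n : ℕ, N ≤ n → 0 < n →
    ∃ m : ℕ, 0 < m ∧
      (f n m : ℝ) > 0.36 * n * Real.log n / Real.log (Real.log n) := by
  have htend : Filter.Tendsto (fun n : ℕ => Real.log n) Filter.atTop Filter.atTop :=
    Real.tendsto_log_atTop.comp tendsto_natCast_atTop_atTop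
  obtain ⟨N, hN⟩ := Filter.eventually_atTop.1
    ((htend.eventually eventually_parameters).and (Filter.eventually_ge_atTop (10 ^ 6)))
  refine ⟨N, fun n hn hn0 => ?_⟩
  obtain ⟨⟨hl, hlog, hexp⟩, hn6⟩ := hN n hn
  set l := Real.log n with hldef
  have hnl : (n : ℝ) = Real.exp l := (Real.exp_log (by exact_mod_cast hn0)).symm
  have hl0 : 0 < l := by linarith
  have hll1 : 1 ≤ Real.log l := by
    rw [Real.le_log_iff_exp_le hl0]
    linarith [Real.exp_one_lt_d9]
  set s := √l with hs
  have hsl : s ^ 2 = l := Real.sq_sqrt hl0.le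
  have hs3 : 1000 ≤ s := by
    rw [hs]
    exact Real.le_sqrt_of_sq_le (by linarith)
  set K := ⌈0.38 * l / Real.log l⌉₊ with hKdef
  set R := ⌊s ^ 5⌋₊ with hRdef
  have hK1 : 0.38 * l / Real.log l ≤ K := Nat.le_ceil _
  have hK2 : (K : ℝ) < 0.38 * l / Real.log l + 1 := Nat.ceil_lt_add_one (by positivity)
  have hK100 : 100 ≤ K := by
    have : (100 : ℝ) ≤ K := by
      refine le_trans ?_ hK1
      rw [le_div_iff₀ (by linarith)]
      exact hlog
    exact_mod_cast this
  have hKl : (K : ℝ) ≤ l := by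
    have : 0.38 * l / Real.log l ≤ 0.38 * l := div_le_self (by positivity) hll1
    linarith
  have hs5 : (10 : ℝ) ≤ s ^ 5 := by
    calc (10 : ℝ) ≤ 1000 ^ 5 := by norm_num
      _ ≤ s ^ 5 := by gcongr
  have hR1 : (R : ℝ) ≤ s ^ 5 := Nat.floor_le (by positivity)
  have hR2 : s ^ 5 / 2 ≤ R := by
    have := Nat.lt_floor_add_one (s ^ 5)
    linarith
  have hRpos : 0 < R := by
    have : (0 : ℝ) < R := by linarith
    exact_mod_cast this
  have hRK : ((R ^ K : ℕ) : ℝ) ≤ Real.exp (0.95 * l) * s ^ 5 := by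
    have hlog5 : Real.log (s ^ 5) = 2.5 * Real.log l := by
      rw [Real.log_pow, hs, Real.log_sqrt hl0.le]
      push_cast
      ring
    push_cast
    calc (R : ℝ) ^ K ≤ (s ^ 5) ^ K := by gcongr
      _ = Real.exp (K * Real.log (s ^ 5)) := by
        rw [mul_comm, Real.exp_mul, Real.exp_log (by positivity), Real.rpow_natCast]
      _ ≤ Real.exp (0.95 * l + Real.log (s ^ 5)) := by
        rw [Real.exp_le_exp, hlog5]
        have h1 : (K : ℝ) * Real.log l ≤ 0.38 * l + Real.log l := by
          calc (K : ℝ) * Real.log l ≤ (0.38 * l / Real.log l + 1) * Real.log l := by gcongr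
            _ = _ := by field_simp
        linarith
      _ = _ := by rw [Real.exp_add, Real.exp_log (by positivity)]
  have hKH : (K : ℝ) * (R ^ K : ℕ) ≤ n / (10 ^ 5 * l) := by
    have hs5l : s ^ 5 ≤ l ^ 3 := by
      rw [← hsl, ← pow_mul]
      exact pow_le_pow_right₀ (by linarith) (by norm_num)
    rw [le_div_iff₀ (by positivity)]
    calc (K : ℝ) * (R ^ K : ℕ) * (10 ^ 5 * l)
        ≤ l * (Real.exp (0.95 * l) * l ^ 3) * (10 ^ 5 * l) := by
          have : ((R ^ K : ℕ) : ℝ) ≤ Real.exp (0.95 * l) * l ^ 3 := hRK.trans (by gcongr)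
          gcongr
      _ = Real.exp (0.95 * l) * (10 ^ 5 * l ^ 5) := by ring
      _ ≤ Real.exp (0.95 * l) * Real.exp (0.05 * l) := by gcongr
      _ = n := by
        rw [← Real.exp_add, hnl]
        congr 1
        ring
  set x := n / 200 with hxdef
  have hx2000 : 2000 ≤ x := by omega
  have hx1 : (n : ℝ) / 400 ≤ x := by
    have : n ≤ 400 * x := by omega
    have : (n : ℝ) ≤ 400 * x := by exact_mod_cast this
    linarith
  have hx2 : (x : ℝ) ≤ n / 200 := by
    have : 200 * x ≤ n := by omega
    have : 200 * (x : ℝ) ≤ n := by exact_mod_cast this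
    linarith
  have hnpos : (0 : ℝ) < n := by exact_mod_cast hn0
  have hxpos : (0 : ℝ) < x := by linarith
  have hHpos : 0 < R ^ K := pow_pos hRpos K
  have hHx : R ^ K ≤ x := by
    have h1 : ((R ^ K : ℕ) : ℝ) ≤ K * (R ^ K : ℕ) := by
      have : (1 : ℝ) ≤ K := by exact_mod_cast (by omega : 1 ≤ K)
      have h0 : (0 : ℝ) ≤ (R ^ K : ℕ) := by positivity
      nlinarith
    have h2 : (n : ℝ) / (10 ^ 5 * l) ≤ n / 400 := by
      gcongr
      linarith
    exact_mod_cast h1.trans (hKH.trans (h2.trans hx1))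
  have hpi : (n : ℝ) / (800 * l) ≤ Nat.primeCounting x := by
    refine le_trans ?_ (half_mul_div_log_le_primeCounting hx2000)
    have hlx : Real.log x ≤ l := Real.log_le_log hxpos (by linarith)
    have hlx0 : 0 < Real.log x := Real.log_pos (by exact_mod_cast (by omega : 1 < x))
    calc (n : ℝ) / (800 * l) = n / 400 / 2 / l := by field_simp; norm_num
      _ ≤ x / 2 / Real.log x := by gcongr
  have hKR : (x : ℝ) * K / R ≤ n / (10 ^ 4 * l) := by
    rw [div_le_div_iff₀ (by positivity) (by positivity)]
    have h1 : (K : ℝ) * l ≤ s ^ 4 := by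
      calc (K : ℝ) * l ≤ l * l := by gcongr
        _ = s ^ 4 := by rw [← hsl]; ring
    have h2 : s ^ 4 * 500 ≤ R := by
      refine le_trans ?_ hR2
      have : 0 ≤ s ^ 4 := by positivity
      nlinarith
    calc (x : ℝ) * K * (10 ^ 4 * l) = (x : ℝ) * (K * l) * 10 ^ 4 := by ring
      _ ≤ (n : ℝ) / 200 * ((R : ℝ) / 500) * 10 ^ 4 := by
        gcongr
        linarith
      _ ≤ (n : ℝ) * R := by
        have : (0 : ℝ) ≤ n * R := by positivity
        linarith
  have hRK1 : R ^ K = R * R ^ (K - 1) := by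
    rw [← pow_succ']
    congr 1
    omega
  have hmain : K * R ^ K + (x / R ^ K + 1) * (K * R ^ (K - 1)) < Nat.primeCounting x := by
    have h1 : ((x / R ^ K : ℕ) : ℝ) * (K * R ^ (K - 1)) ≤ x * K / R := by
      have hd : ((x / R ^ K : ℕ) : ℝ) ≤ x / (R ^ K : ℕ) := Nat.cast_div_le
      have hRr : (0 : ℝ) < R := by exact_mod_cast hRpos
      calc ((x / R ^ K : ℕ) : ℝ) * (K * R ^ (K - 1))
          ≤ x / (R ^ K : ℕ) * (K * R ^ (K - 1)) := by gcongr
        _ = x * K / R := by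
          rw [hRK1]
          push_cast
          field_simp
    have h2 : (K : ℝ) * R ^ (K - 1) ≤ K * (R ^ K : ℕ) := by
      have : R ^ (K - 1) ≤ R ^ K := Nat.pow_le_pow_right hRpos (by omega)
      have : ((R : ℝ)) ^ (K - 1) ≤ (R ^ K : ℕ) := by exact_mod_cast this
      gcongr
    have h3 : (n : ℝ) / (10 ^ 5 * l) = n / l / 10 ^ 5 := by field_simp
    have h4 : (n : ℝ) / (10 ^ 4 * l) = n / l / 10 ^ 4 := by field_simp
    have h5 : (n : ℝ) / (800 * l) = n / l / 800 := by field_simp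
    have h6 : (0 : ℝ) < n / l := by positivity
    have : (K : ℝ) * (R ^ K : ℕ) + (((x / R ^ K : ℕ) : ℝ) + 1) * (K * R ^ (K - 1))
        < Nat.primeCounting x := by
      rw [h3] at hKH
      rw [h4] at hKR
      rw [h5] at hpi
      linarith
    exact_mod_cast this
  obtain ⟨m, hm, hf⟩ := exists_f_ge hRpos hK100 hHx hmain
  refine ⟨m, hm, lt_of_lt_of_le ?_ hf⟩
  have hq : 0 < l / Real.log l := by positivity
  have hK3 : 0.38 * (l / Real.log l) ≤ K := by rw [← mul_div_assoc]; exact hK1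
  calc 0.36 * (n : ℝ) * l / Real.log l = 0.36 * (l / Real.log l) * n := by ring
    _ < 0.98 * (0.38 * (l / Real.log l)) * n := by
      gcongr ?_ * _
      linarith
    _ ≤ 0.98 * (K : ℝ) * n := by gcongr
end

section
/- For every real ε > 0 there exists N such that for all integers n ≥ N, one has f(n, n) < (2 + ε) · n · √(log n). (Here log denotes the natural logarithm.) -/
open Real

lemma mul_log_sub_self_mono {a b : ℝ} (ha : 1 ≤ a) (hab : a ≤ b) :
    a * log a - a ≤ b * log b - b := by
  have ha0 : 0 < a := by linarith
  have hb0 : 0 < b := by linarith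
  have h1 : log (a / b) ≤ a / b - 1 := log_le_sub_one_of_pos (by positivity)
  rw [log_div ha0.ne' hb0.ne'] at h1
  have h2 : b * (log a - log b) ≤ a - b := by
    calc b * (log a - log b) ≤ b * (a / b - 1) := by gcongr
      _ = a - b := by field_simp
  nlinarith [log_nonneg ha]

lemma le_log_factorial {n : ℕ} (hn : 1 ≤ n) :
    n * log n - n ≤ log (n.factorial) := by
  induction n, hn using Nat.le_induction with
  | base => simp
  | succ n hn ih =>
    have hn0 : (0 : ℝ) < n := by exact_mod_cast hn
    have h1 : log ((n + 1) / n : ℝ) ≤ (n + 1) / n - 1 := log_le_sub_one_of_pos (by positivity)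
    rw [log_div (by positivity) hn0.ne'] at h1
    have h2 : n * (log (n + 1) - log n) ≤ 1 := by
      calc n * (log (n + 1) - log n) ≤ n * ((n + 1) / n - 1 : ℝ) := by gcongr
        _ = 1 := by field_simp; ring
    rw [Nat.factorial_succ, Nat.cast_mul, log_mul (by positivity) (by positivity)]
    push_cast
    linarith

lemma log_factorial_le {n : ℕ} (hn : 1 ≤ n) :
    log (n.factorial) ≤ n * log n - n + log n + 1 := by
  induction n, hn using Nat.le_induction with
  | base => simp
  | succ n hn ih =>
    have hn0 : (0 : ℝ) < n := by exact_mod_cast hn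
    have h1 : log (n / (n + 1) : ℝ) ≤ n / (n + 1) - 1 := log_le_sub_one_of_pos (by positivity)
    rw [log_div hn0.ne' (by positivity)] at h1
    have h2 : (n + 1) * (log n - log (n + 1)) ≤ -1 := by
      calc (n + 1) * (log n - log (n + 1)) ≤ (n + 1) * (n / (n + 1) - 1 : ℝ) := by gcongr
        _ = -1 := by field_simp; ring
    rw [Nat.factorial_succ, Nat.cast_mul, log_mul (by positivity) (by positivity)]
    push_cast
    linarith

lemma abs_log_factorial_floor_sub_le {x : ℝ} (hx : 1 ≤ x) :
    |log (⌊x⌋₊.factorial) - (x * log x - x)| ≤ log x + 1 := by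
  have hM : 1 ≤ ⌊x⌋₊ := Nat.one_le_floor_iff x |>.2 hx
  have hM' : (1 : ℝ) ≤ ⌊x⌋₊ := by exact_mod_cast hM
  have hle : (⌊x⌋₊ : ℝ) ≤ x := Nat.floor_le (by linarith)
  have hlt : x < ⌊x⌋₊ + 1 := Nat.lt_floor_add_one x
  rw [abs_le]
  constructor
  · have h1 := le_log_factorial (n := ⌊x⌋₊ + 1) (by omega)
    rw [Nat.factorial_succ, Nat.cast_mul, log_mul (by positivity) (by positivity)] at h1
    push_cast at h1
    have h2 := mul_log_sub_self_mono hx hlt.le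
    have h3 : log (⌊x⌋₊ + 1 : ℝ) ≤ log x + 1 := by
      have : log (⌊x⌋₊ + 1 : ℝ) ≤ log (x * 2) := log_le_log (by positivity) (by linarith)
      rw [log_mul (by positivity) (by norm_num)] at this
      linarith [log_two_lt_d9]
    linarith
  · have h1 := log_factorial_le hM
    have h2 := mul_log_sub_self_mono hM' hle
    have h3 : log (⌊x⌋₊ : ℝ) ≤ log x := log_le_log (by positivity) hle
    linarith

open ArithmeticFunction (vonMangoldt vonMangoldt_nonneg) in
lemma log_factorial_eq_sum_vonMangoldt (n : ℕ) :
    log (n.factorial) = ∑ d ∈ Finset.Ioc 0 n, vonMangoldt d * (n / d : ℕ) := by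
  rw [← ArithmeticFunction.sum_Ioc_mul_zeta_eq_sum, ArithmeticFunction.vonMangoldt_mul_zeta]
  induction n with
  | zero => simp
  | succ n ih =>
    rw [Finset.sum_Ioc_succ_top (by omega), ← ih, Nat.factorial_succ, Nat.cast_mul,
      log_mul (by positivity) (by positivity), add_comm]
    rfl

open ArithmeticFunction (vonMangoldt vonMangoldt_nonneg) in
lemma log_factorial_div_eq_sum_vonMangoldt (n k : ℕ) :
    log ((n / k).factorial) = ∑ d ∈ Finset.Ioc 0 n, vonMangoldt d * (n / d / k : ℕ) := by
  rw [log_factorial_eq_sum_vonMangoldt]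
  have : ∀ d, n / k / d = n / d / k := fun d => by
    rw [Nat.div_div_eq_div_mul, Nat.div_div_eq_div_mul, mul_comm]
  simp_rw [this]
  apply Finset.sum_subset
  · exact Finset.Ioc_subset_Ioc_right (Nat.div_le_self _ _)
  · intro d hd hd'
    have h : n / k < d := by
      simp only [Finset.mem_Ioc, not_and, not_le] at hd hd'
      exact hd' hd.1
    rw [← this, Nat.div_eq_of_lt h]
    simp

/-- Chebyshev's alternating combination of logarithms of factorials. -/
noncomputable def chebyshevSum (n : ℕ) : ℝ :=
  log (n.factorial) - log ((n / 2).factorial) - log ((n / 3).factorial)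
    - log ((n / 5).factorial) + log ((n / 30).factorial)

open ArithmeticFunction (vonMangoldt vonMangoldt_nonneg) in
lemma chebyshevSum_eq (n : ℕ) :
    chebyshevSum n = ∑ d ∈ Finset.Ioc 0 n, vonMangoldt d *
      (((n / d : ℕ) : ℤ) - (n / d / 2 : ℕ) - (n / d / 3 : ℕ) - (n / d / 5 : ℕ)
        + (n / d / 30 : ℕ) : ℤ) := by
  simp only [chebyshevSum, log_factorial_div_eq_sum_vonMangoldt]
  rw [log_factorial_eq_sum_vonMangoldt]
  simp only [← Finset.sum_sub_distrib, ← Finset.sum_add_distrib]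
  refine Finset.sum_congr rfl fun d _ => ?_
  simp only [Int.cast_add, Int.cast_sub, Int.cast_natCast]
  ring

open ArithmeticFunction (vonMangoldt vonMangoldt_nonneg) in
lemma chebyshevSum_le_psi (n : ℕ) : chebyshevSum n ≤ Chebyshev.psi n := by
  rw [chebyshevSum_eq, Chebyshev.psi, Nat.floor_natCast]
  refine Finset.sum_le_sum fun d _ => ?_
  refine mul_le_of_le_one_right vonMangoldt_nonneg ?_
  have : (((n / d : ℕ) : ℤ) - (n / d / 2 : ℕ) - (n / d / 3 : ℕ) - (n / d / 5 : ℕ)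
        + (n / d / 30 : ℕ) : ℤ) ≤ 1 := by
    generalize n / d = q
    omega
  exact_mod_cast this

open ArithmeticFunction (vonMangoldt vonMangoldt_nonneg) in
lemma psi_sub_psi_le_chebyshevSum (n : ℕ) :
    Chebyshev.psi n - Chebyshev.psi (n / 6 : ℕ) ≤ chebyshevSum n := by
  rw [chebyshevSum_eq, Chebyshev.psi, Chebyshev.psi, Nat.floor_natCast, Nat.floor_natCast,
    sub_le_iff_le_add, ← Finset.sum_Ioc_consecutive _ (Nat.zero_le (n / 6)) (Nat.div_le_self n 6),
    ← Finset.sum_Ioc_consecutive _ (Nat.zero_le (n / 6)) (Nat.div_le_self n 6)]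
  have h0 : ∀ q : ℕ, (0 : ℤ) ≤ (q : ℤ) - (q / 2 : ℕ) - (q / 3 : ℕ) - (q / 5 : ℕ) + (q / 30 : ℕ) := by
    intro q; omega
  have h1 : 0 ≤ ∑ d ∈ Finset.Ioc 0 (n / 6), vonMangoldt d *
      ((((n / d : ℕ) : ℤ) - (n / d / 2 : ℕ) - (n / d / 3 : ℕ) - (n / d / 5 : ℕ)
        + (n / d / 30 : ℕ) : ℤ) : ℝ) :=
    Finset.sum_nonneg fun d _ => mul_nonneg vonMangoldt_nonneg (by exact_mod_cast h0 _)
  have h2 : ∑ d ∈ Finset.Ioc (n / 6) n, vonMangoldt d ≤ ∑ d ∈ Finset.Ioc (n / 6) n, vonMangoldt d *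
      ((((n / d : ℕ) : ℤ) - (n / d / 2 : ℕ) - (n / d / 3 : ℕ) - (n / d / 5 : ℕ)
        + (n / d / 30 : ℕ) : ℤ) : ℝ) := by
    refine Finset.sum_le_sum fun d hd => ?_
    refine le_mul_of_one_le_right vonMangoldt_nonneg ?_
    rw [Finset.mem_Ioc] at hd
    have hd0 : 0 < d := by omega
    have ha : 1 ≤ n / d := (Nat.one_le_div_iff hd0).2 hd.2
    have hb : n / d < 6 := by
      rw [Nat.div_lt_iff_lt_mul hd0]
      omega
    have : (1 : ℤ) ≤ (((n / d : ℕ) : ℤ) - (n / d / 2 : ℕ) - (n / d / 3 : ℕ) - (n / d / 5 : ℕ)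
        + (n / d / 30 : ℕ) : ℤ) := by
      generalize n / d = q at *
      omega
    exact_mod_cast this
  linarith

lemma abs_log_factorial_div_sub_le {n k : ℕ} (hk : 1 ≤ k) (hn : k ≤ n) :
    |log ((n / k).factorial) - (n / k * (log n - log k) - n / k)| ≤ log n + 1 := by
  have hk0 : (0 : ℝ) < k := by exact_mod_cast hk
  have hn0 : (0 : ℝ) < n := by exact_mod_cast hk.trans hn
  have h := abs_log_factorial_floor_sub_le (x := (n / k : ℝ))
    ((one_le_div hk0).2 (by exact_mod_cast hn))
  rw [Nat.floor_div_eq_div, log_div hn0.ne' hk0.ne'] at h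
  have : 0 ≤ log (k : ℝ) := log_natCast_nonneg k
  linarith

lemma abs_chebyshevSum_sub_le {n : ℕ} (hn : 30 ≤ n) :
    |chebyshevSum n - (log 2 / 2 + log 3 / 3 + log 5 / 5 - log 30 / 30) * n| ≤
      5 * (log n + 1) := by
  have h1 := abs_log_factorial_div_sub_le (n := n) (k := 1) (by norm_num) (by omega)
  have h2 := abs_log_factorial_div_sub_le (n := n) (k := 2) (by norm_num) (by omega)
  have h3 := abs_log_factorial_div_sub_le (n := n) (k := 3) (by norm_num) (by omega)
  have h5 := abs_log_factorial_div_sub_le (n := n) (k := 5) (by norm_num) (by omega)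
  have h30 := abs_log_factorial_div_sub_le (n := n) (k := 30) (by norm_num) (by omega)
  simp only [Nat.div_one, Nat.cast_one, log_one, div_one, sub_zero, Nat.cast_ofNat] at h1 h2 h3 h5 h30
  rw [abs_le] at *
  unfold chebyshevSum
  constructor <;> linarith [h1.1, h1.2, h2.1, h2.2, h3.1, h3.2, h5.1, h5.2, h30.1, h30.2]

lemma chebyshev_constant_bounds :
    0.92 ≤ log 2 / 2 + log 3 / 3 + log 5 / 5 - log 30 / 30 ∧
      log 2 / 2 + log 3 / 3 + log 5 / 5 - log 30 / 30 ≤ 0.923 := by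
  have h30 : log 30 = log 2 + log 3 + log 5 := by
    rw [← log_mul (by norm_num) (by norm_num), ← log_mul (by norm_num) (by norm_num)]
    norm_num
  have hu : 3 * log 5 ≤ 7 * log 2 := by
    have := log_le_log (x := 5 ^ 3) (y := 2 ^ 7) (by norm_num) (by norm_num)
    rwa [log_pow, log_pow] at this
  have hl : log 3 + 10 * log 2 ≤ 5 * log 5 := by
    have := log_le_log (x := 3 * 2 ^ 10) (y := 5 ^ 5) (by norm_num) (by norm_num)
    rwa [log_mul (by norm_num) (by norm_num), log_pow, log_pow] at this
  have h3 := abs_le.1 log_three_near_10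
  rw [h30]
  constructor <;> linarith [log_two_lt_d9, log_two_gt_d9, h3.1, h3.2]

lemma eventually_log_add_one_le_mul {δ : ℝ} (hδ : 0 < δ) :
    ∀ᶠ n : ℕ in Filter.atTop, 5 * (log n + 1) ≤ δ * n := by
  have h1 := (isLittleO_log_id_atTop.comp_tendsto (tendsto_natCast_atTop_atTop (R := ℝ))).bound
    (show 0 < δ / 10 by positivity)
  filter_upwards [h1, Filter.eventually_ge_atTop ⌈10 / δ⌉₊] with n h1 h2
  simp only [Function.comp, id, norm_eq_abs, Nat.abs_cast] at h1
  have h3 : 10 / δ ≤ n := Nat.ceil_le.1 h2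
  rw [div_le_iff₀ hδ] at h3
  linarith [le_abs_self (log n)]

lemma eventually_psi_nat_ge : ∀ᶠ n : ℕ in Filter.atTop, 0.919 * (n : ℝ) ≤ Chebyshev.psi n := by
  filter_upwards [eventually_log_add_one_le_mul (δ := 0.001) (by norm_num),
    Filter.eventually_ge_atTop 30] with n h1 h2
  have h3 := (abs_le.1 (abs_chebyshevSum_sub_le h2)).1
  have h4 := chebyshev_constant_bounds.1
  have h5 := chebyshevSum_le_psi n
  have : 0.92 * (n : ℝ) ≤ (log 2 / 2 + log 3 / 3 + log 5 / 5 - log 30 / 30) * n := by gcongr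
  linarith

lemma exists_psi_nat_le : ∃ C : ℝ, ∀ n : ℕ, Chebyshev.psi n ≤ 1.11 * n + C := by
  obtain ⟨M, hM⟩ := Filter.eventually_atTop.1
    (eventually_log_add_one_le_mul (δ := 0.002) (by norm_num))
  refine ⟨Chebyshev.psi (M + 30 : ℕ), fun n => ?_⟩
  induction n using Nat.strong_induction_on with
  | _ n ih =>
    rcases le_total n (M + 30) with h | h
    · have := Chebyshev.psi_mono (show (n : ℝ) ≤ (M + 30 : ℕ) by exact_mod_cast h)
      have : (0 : ℝ) ≤ n := by positivity
      linarith
    · have h1 := ih (n / 6) (by omega)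
      have h2 := psi_sub_psi_le_chebyshevSum n
      have h3 := (abs_le.1 (abs_chebyshevSum_sub_le (n := n) (by omega))).2
      have h4 := chebyshev_constant_bounds.2
      have h5 := hM n (by omega)
      have h6 : ((n / 6 : ℕ) : ℝ) ≤ n / 6 := Nat.cast_div_le
      have : (log 2 / 2 + log 3 / 3 + log 5 / 5 - log 30 / 30) * n ≤ 0.923 * (n : ℝ) := by gcongr
      linarith

lemma eventually_theta_bounds :
    ∀ᶠ x : ℝ in Filter.atTop, 0.91 * x ≤ Chebyshev.theta x ∧ Chebyshev.theta x ≤ 1.12 * x := by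
  obtain ⟨C, hC⟩ := exists_psi_nat_le
  obtain ⟨D, hD⟩ := Chebyshev.psi_sub_theta_le_mul_sqrt
  have hs : ∀ᶠ x : ℝ in Filter.atTop, D * √x ≤ 0.001 * x := by
    filter_upwards [Filter.eventually_ge_atTop ((1000 * D) ^ 2), Filter.eventually_ge_atTop 0]
      with x hx hx0
    have h1 : 1000 * D ≤ √x := le_sqrt_of_sq_le hx
    nlinarith [sq_sqrt hx0, sqrt_nonneg x]
  filter_upwards [hs, Filter.eventually_ge_atTop 1000, Filter.eventually_ge_atTop (100 * C),
    tendsto_nat_floor_atTop.eventually eventually_psi_nat_ge] with x h1 h2 h3 h4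
  have hle : (⌊x⌋₊ : ℝ) ≤ x := Nat.floor_le (by linarith)
  have hlt : x < ⌊x⌋₊ + 1 := Nat.lt_floor_add_one x
  rw [← Chebyshev.psi_eq_psi_coe_floor] at h4
  have h5 := hC ⌊x⌋₊
  rw [← Chebyshev.psi_eq_psi_coe_floor] at h5
  have h6 := hD x
  have h7 := Chebyshev.theta_le_psi x
  constructor <;> linarith

/-- The primes `p` for which `t * p` lies in `(n * k, n * K]`. -/
def primeCofactors (n k K t : ℕ) : Finset ℕ :=
  {p ∈ Finset.Ioc (n * k / t) (n * K / t) | p.Prime}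

lemma sum_primeCofactors {n k K t : ℕ} (hkK : k ≤ K) :
    ∑ p ∈ primeCofactors n k K t, log p =
      Chebyshev.theta (n / t * K) - Chebyshev.theta (n / t * k) := by
  have h : ∀ j : ℕ, ⌊(n / t * j : ℝ)⌋₊ = n * j / t := fun j => by
    rw [div_mul_eq_mul_div, ← Nat.cast_mul, Nat.floor_div_eq_div]
  rw [Chebyshev.theta, Chebyshev.theta, h, h, eq_sub_iff_add_eq, primeCofactors, Finset.sum_filter,
    Finset.sum_filter, Finset.sum_filter, add_comm]
  exact Finset.sum_Ioc_consecutive _ (Nat.zero_le _) (Nat.div_le_div_right (by gcongr))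

lemma sum_log_primeFactors_le {a : ℕ} (ha : a ≠ 0) : ∑ p ∈ a.primeFactors, log p ≤ log a := by
  rw [← log_prod fun p hp => by exact_mod_cast (Nat.prime_of_mem_primeFactors hp).ne_zero]
  have h := Nat.le_of_dvd (Nat.pos_of_ne_zero ha) (Nat.prod_primeFactors_dvd a)
  rw [← Nat.cast_prod]
  refine log_le_log ?_ (by exact_mod_cast h)
  rw [Nat.cast_prod]
  refine Finset.prod_pos fun p hp => ?_
  exact_mod_cast (Nat.prime_of_mem_primeFactors hp).pos

/-- The multipliers applied to `i` before multiplying by a prime. -/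
def multipliers (n k i : ℕ) : Finset ℕ := if 2 * k * i ≤ n then {1} else {1, 2}

lemma eq_one_or_of_mem_multipliers {n k i m : ℕ} (hm : m ∈ multipliers n k i) :
    m = 1 ∨ m = 2 ∧ n < 2 * k * i := by
  unfold multipliers at hm
  split_ifs at hm <;> simp at hm <;> omega

lemma mul_multiplier_injective {n k i m i' m' : ℕ} (hi : k * i ≤ n) (hi' : k * i' ≤ n)
    (hm : m ∈ multipliers n k i) (hm' : m' ∈ multipliers n k i') (h : i * m = i' * m') :
    i = i' ∧ m = m' := by
  rcases eq_one_or_of_mem_multipliers hm with rfl | ⟨rfl, h1⟩ <;>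
  rcases eq_one_or_of_mem_multipliers hm' with rfl | ⟨rfl, h2⟩
  · omega
  · have : i = 2 * i' := by omega
    subst this
    nlinarith
  · have : i' = 2 * i := by omega
    subst this
    nlinarith
  · omega

lemma exists_injective_prime_multiples {n k K : ℕ} (hnK : 1 < n * K)
    (hD : ∀ i, 1 ≤ i → k * i ≤ n → log (n * K : ℕ) ≤
      ∑ m ∈ multipliers n k i, ∑ p ∈ primeCofactors n k K (i * m), log p) :
    ∃ a : {i : ℕ // 1 ≤ i ∧ k * i ≤ n} → ℕ, Function.Injective a ∧
      ∀ i, i.1 ∣ a i ∧ n * k < a i ∧ a i ≤ n * K := by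
  classical
  let nbr : {i : ℕ // 1 ≤ i ∧ k * i ≤ n} → Finset ℕ := fun i =>
    {a ∈ Finset.Ioc (n * k) (n * K) | i.1 ∣ a}
  obtain ⟨a, ha, hmem⟩ :=
    (Finset.all_card_le_biUnion_card_iff_exists_injective nbr).1 fun s => by
      set N := s.biUnion nbr with hN
      set D := log (n * K : ℕ) with hDdef
      have hDpos : 0 < D := log_pos (by exact_mod_cast hnK)
      let E : Finset (Σ _ : {i : ℕ // 1 ≤ i ∧ k * i ≤ n}, Σ _ : ℕ, ℕ) :=
        s.sigma fun i => (multipliers n k i.1).sigma fun m => primeCofactors n k K (i.1 * m)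
      let g : (Σ _ : {i : ℕ // 1 ≤ i ∧ k * i ≤ n}, Σ _ : ℕ, ℕ) → Σ _ : ℕ, ℕ :=
        fun e => ⟨e.1.1 * e.2.1 * e.2.2, e.2.2⟩
      have hEmem : ∀ e ∈ E, e.1 ∈ s ∧ e.2.1 ∈ multipliers n k e.1.1 ∧
          e.2.2.Prime ∧ 0 < e.1.1 * e.2.1 ∧
          n * k < e.1.1 * e.2.1 * e.2.2 ∧ e.1.1 * e.2.1 * e.2.2 ≤ n * K := by
        rintro ⟨i, m, p⟩ he
        simp only [E, Finset.mem_sigma, primeCofactors, Finset.mem_filter, Finset.mem_Ioc] at he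
        obtain ⟨hi, hm, ⟨h1, h2⟩, hp⟩ := he
        have him : 0 < i.1 * m := by
          have := i.2.1
          rcases eq_one_or_of_mem_multipliers hm with rfl | ⟨rfl, -⟩ <;> omega
        rw [Nat.div_lt_iff_lt_mul him, mul_comm p] at h1
        rw [Nat.le_div_iff_mul_le him, mul_comm p] at h2
        exact ⟨hi, hm, hp, him, h1, h2⟩
      have hinj : Set.InjOn g E := by
        rintro ⟨i, m, p⟩ he ⟨i', m', p'⟩ he' hg
        obtain ⟨-, hm, hp, -⟩ := hEmem _ he
        obtain ⟨-, hm', -⟩ := hEmem _ he'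
        simp only [g, Sigma.mk.injEq, heq_eq_eq] at hg
        obtain ⟨hg, rfl⟩ := hg
        obtain ⟨h1, rfl⟩ := mul_multiplier_injective i.2.2 i'.2.2 hm hm'
          (Nat.eq_of_mul_eq_mul_right hp.pos hg)
        rw [Subtype.ext h1]
      have hsub : E.image g ⊆ N.sigma fun a => a.primeFactors := by
        intro x hx
        obtain ⟨e, he, rfl⟩ := Finset.mem_image.1 hx
        obtain ⟨hs, -, hp, hpos, h1, h2⟩ := hEmem e he
        simp only [g, Finset.mem_sigma, hN, Finset.mem_biUnion, nbr, Finset.mem_filter,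
          Finset.mem_Ioc, Nat.mem_primeFactors]
        exact ⟨⟨e.1, hs, ⟨h1, h2⟩, ⟨e.2.1 * e.2.2, by ring⟩⟩, hp, ⟨_, mul_comm _ _⟩,
          (Nat.mul_pos hpos hp.pos).ne'⟩
      have hcount : (s.card : ℝ) * D ≤ N.card * D :=
        calc (s.card : ℝ) * D = ∑ i ∈ s, D := by simp
          _ ≤ ∑ i ∈ s, ∑ m ∈ multipliers n k i.1,
              ∑ p ∈ primeCofactors n k K (i.1 * m), log p :=
            Finset.sum_le_sum fun i _ => hD i.1 i.2.1 i.2.2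
          _ = ∑ e ∈ E, log (g e).2 := by simp only [E, g, Finset.sum_sigma]
          _ = ∑ x ∈ E.image g, log x.2 := 
            (Finset.sum_image (f := fun x : Σ _ : ℕ, ℕ => log x.2) hinj).symm
          _ ≤ ∑ x ∈ N.sigma fun a => a.primeFactors, log x.2 :=
            Finset.sum_le_sum_of_subset_of_nonneg hsub fun x _ _ => log_natCast_nonneg _
          _ = ∑ a ∈ N, ∑ p ∈ a.primeFactors, log p := by rw [Finset.sum_sigma]
          _ ≤ ∑ a ∈ N, D := by
            refine Finset.sum_le_sum fun a ha => ?_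
            simp only [hN, Finset.mem_biUnion, nbr, Finset.mem_filter, Finset.mem_Ioc] at ha
            obtain ⟨i, -, ⟨h1, h2⟩, -⟩ := ha
            refine (sum_log_primeFactors_le (by omega)).trans (log_le_log ?_ ?_)
            · exact_mod_cast (show 0 < a by omega)
            · exact_mod_cast h2
          _ = N.card * D := by simp
      exact_mod_cast le_of_mul_le_mul_right hcount hDpos
  refine ⟨a, ha, fun i => ?_⟩
  have := hmem i
  simp only [nbr, Finset.mem_filter, Finset.mem_Ioc] at this
  tauto

lemma f_self_le_s4 {n k K : ℕ} (hk : 1 ≤ k) (hkK : k ≤ K) (hnK : 1 < n * K)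
    (hD : ∀ i, 1 ≤ i → k * i ≤ n → log (n * K : ℕ) ≤
      ∑ m ∈ multipliers n k i, ∑ p ∈ primeCofactors n k K (i * m), log p) :
    f n n ≤ n * (K - 1) := by
  classical
  obtain ⟨b, hb, hb'⟩ := exists_injective_prime_multiples hnK hD
  let a : ℕ → ℕ := fun i =>
    if h : 1 ≤ i ∧ k * i ≤ n then b ⟨i, h⟩ else i * (n / i) * (n / i + 1)
  have hlarge : ∀ i, 1 ≤ i ∧ k * i ≤ n → i ∣ a i ∧ n * k < a i ∧ a i ≤ n * K := by
    intro i h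
    simp only [a, dif_pos h]
    exact hb' ⟨i, h⟩
  have hsmall : ∀ i, 1 ≤ i → i ≤ n → ¬ (1 ≤ i ∧ k * i ≤ n) →
      a i = i * (n / i) * (n / i + 1) ∧ 1 ≤ n / i ∧ n / i < k ∧
        n * (n / i) < a i ∧ a i ≤ n * (n / i + 1) := by
    intro i h1 h2 h3
    have h4 : a i = i * (n / i) * (n / i + 1) := by simp only [a, dif_neg h3]
    have h5 : i * (n / i) ≤ n := Nat.mul_div_le n i
    have h6 : n < i * (n / i + 1) := Nat.lt_mul_div_succ n h1
    have h7 : 1 ≤ n / i := (Nat.one_le_div_iff h1).2 h2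
    refine ⟨h4, h7, ?_, ?_, ?_⟩
    · rw [Nat.div_lt_iff_lt_mul h1]
      omega
    · rw [h4]
      calc n * (n / i) < i * (n / i + 1) * (n / i) := by gcongr
        _ = _ := by ring
    · rw [h4]
      gcongr
  have hsmall_le : ∀ i, 1 ≤ i → i ≤ n → ¬ (1 ≤ i ∧ k * i ≤ n) → n < a i ∧ a i ≤ n * k := by
    intro i h1 h2 h3
    obtain ⟨-, h5, h6, h7, h8⟩ := hsmall i h1 h2 h3
    exact ⟨(Nat.le_mul_of_pos_right n h5).trans_lt h7, h8.trans (by gcongr; omega)⟩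
  refine Nat.sInf_le ⟨a, fun i hi => ?_, fun i hi => ?_, fun i hi j hj hij => ?_⟩
  · rw [Finset.mem_Icc] at hi
    by_cases h : 1 ≤ i ∧ k * i ≤ n
    · exact (hlarge i h).1
    · rw [(hsmall i hi.1 hi.2 h).1, mul_assoc]
      exact dvd_mul_right _ _
  · rw [Finset.mem_Icc] at hi
    have hL : n + n * (K - 1) = n * K := by
      obtain ⟨c, rfl⟩ : ∃ c, K = c + 1 := ⟨K - 1, by omega⟩
      simp [mul_add, add_comm]
    rw [hL]
    by_cases h : 1 ≤ i ∧ k * i ≤ n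
    · obtain ⟨-, h1, h2⟩ := hlarge i h
      exact ⟨(Nat.le_mul_of_pos_right n hk).trans_lt h1, h2⟩
    · obtain ⟨h1, h2⟩ := hsmall_le i hi.1 hi.2 h
      exact ⟨h1, h2.trans (by gcongr)⟩
  · rw [Finset.mem_coe, Finset.mem_Icc] at hi hj
    by_cases h : 1 ≤ i ∧ k * i ≤ n <;> by_cases h' : 1 ≤ j ∧ k * j ≤ n
    · simp only [a, dif_pos h, dif_pos h'] at hij
      exact congrArg Subtype.val (hb hij)
    · have h1 := (hlarge i h).2.1
      have h2 := (hsmall_le j hj.1 hj.2 h').2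
      omega
    · have h1 := (hlarge j h').2.1
      have h2 := (hsmall_le i hi.1 hi.2 h).2
      omega
    · obtain ⟨h1, h2, -, h3, h4⟩ := hsmall i hi.1 hi.2 h
      obtain ⟨h1', h2', -, h3', h4'⟩ := hsmall j hj.1 hj.2 h'
      have hlt : n / i < n / j + 1 := lt_of_mul_lt_mul_left (by omega) (Nat.zero_le n)
      have hlt' : n / j < n / i + 1 := lt_of_mul_lt_mul_left (by omega) (Nat.zero_le n)
      have heq : n / j = n / i := by omega
      rw [h1, h1', heq, mul_assoc, mul_assoc] at hij
      exact Nat.eq_of_mul_eq_mul_right (by positivity) hij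

lemma log_le_sum_primeCofactors {n k K i : ℕ} {s x₀ : ℝ}
    (hθ : ∀ x ≥ x₀, 0.91 * x ≤ Chebyshev.theta x ∧ Chebyshev.theta x ≤ 1.12 * x)
    (hs : s ^ 2 = log n) (hs100 : 100 ≤ s) (hsx : x₀ ≤ s)
    (hk : 0.79 * s ≤ k) (hk' : k ≤ 0.8 * s) (hK : 1.99 * s ≤ K) (hK' : K ≤ 2 * s)
    (hi : 1 ≤ i) (hki : k * i ≤ n) :
    log (n * K : ℕ) ≤
      ∑ m ∈ multipliers n k i, ∑ p ∈ primeCofactors n k K (i * m), log p := by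
  have hi0 : (0 : ℝ) < i := by exact_mod_cast hi
  have hkK : k ≤ K := by
    have : (k : ℝ) ≤ K := by linarith
    exact_mod_cast this
  have hn0 : (n : ℝ) ≠ 0 := by
    rintro h
    rw [h, log_zero] at hs
    nlinarith
  have hK0 : (0 : ℝ) < K := by linarith
  have hlog : log (n * K : ℕ) ≤ 1.07 * s ^ 2 := by
    rw [Nat.cast_mul, log_mul hn0 hK0.ne', ← hs]
    have := log_le_sub_one_of_pos hK0
    nlinarith
  have hgap : ∀ y : ℝ, 0.39 * s ≤ y →
      0.91 * s * y ≤ Chebyshev.theta (y * K) - Chebyshev.theta (y * k) := by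
    intro y hy
    have hy0 : 0 < y := by linarith
    have h1 : x₀ ≤ y * k := by nlinarith
    have h2 : y * k ≤ y * K := by gcongr
    have h3 := (hθ _ (h1.trans h2)).1
    have h4 := (hθ _ h1).2
    have h5 : y * k ≤ y * (0.8 * s) := by gcongr
    have h6 : y * (1.99 * s) ≤ y * K := by gcongr
    nlinarith [mul_pos hy0 (show 0 < s by linarith)]
  have hy : (k : ℝ) ≤ n / i := by
    rw [le_div_iff₀ hi0]
    exact_mod_cast hki
  unfold multipliers
  split_ifs with h
  · rw [Finset.sum_singleton, mul_one, sum_primeCofactors hkK]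
    have hy2 : 2 * (k : ℝ) ≤ n / i := by
      rw [le_div_iff₀ hi0]
      exact_mod_cast h
    have h1 := hgap (n / i) (by linarith)
    nlinarith
  · rw [Finset.sum_pair (by norm_num), mul_one, sum_primeCofactors hkK, sum_primeCofactors hkK]
    have h1 := hgap (n / i) (by linarith)
    have h2 := hgap (n / (i * 2 : ℕ)) (by
      push_cast
      rw [← div_div]
      linarith)
    have h3 : (n / (i * 2 : ℕ) : ℝ) = n / i / 2 := by
      push_cast
      rw [div_div]
    rw [h3] at h2 ⊢
    nlinarith

theorem stmt_4 : ∀ ε : ℝ, ε > 0 → ∃ N : ℕ, ∀ n : ℕ, N ≤ n → 0 < n →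
    (f n n : ℝ) < (2 + ε) * n * Real.sqrt (Real.log n) := by
  intro ε hε
  obtain ⟨x₀, hθ⟩ := Filter.eventually_atTop.1 eventually_theta_bounds
  have hsqrt : Filter.Tendsto (fun n : ℕ => √(log n)) Filter.atTop Filter.atTop :=
    tendsto_sqrt_atTop.comp (tendsto_log_atTop.comp tendsto_natCast_atTop_atTop)
  obtain ⟨N, hN⟩ := Filter.eventually_atTop.1
    (hsqrt.eventually (Filter.eventually_ge_atTop (max 100 x₀)))
  refine ⟨N, fun n hn hn0 => ?_⟩
  have hs := hN n hn
  set s := √(log n) with hsdef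
  have hs100 : 100 ≤ s := (le_max_left _ _).trans hs
  have hsq : s ^ 2 = log n := sq_sqrt (log_natCast_nonneg n)
  have hk := Nat.floor_le (show 0 ≤ 0.8 * s by linarith)
  have hk' := Nat.lt_floor_add_one (0.8 * s)
  have hK := Nat.floor_le (show 0 ≤ 2 * s by linarith)
  have hK' := Nat.lt_floor_add_one (2 * s)
  set k := ⌊0.8 * s⌋₊
  set K := ⌊2 * s⌋₊
  have hk1 : 1 ≤ k := by
    have : (1 : ℝ) ≤ k := by linarith
    exact_mod_cast this
  have hkK : k ≤ K := by
    have : (k : ℝ) ≤ K := by linarith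
    exact_mod_cast this
  have hK2 : 1 < K := by
    have : (1 : ℝ) < K := by linarith
    exact_mod_cast this
  have hle := f_self_le_s4 hk1 hkK (hK2.trans_le (Nat.le_mul_of_pos_left K hn0)) fun i hi hki =>
    log_le_sum_primeCofactors hθ hsq hs100 ((le_max_right _ _).trans hs) (by linarith) hk
      (by linarith) hK hi hki
  have hn0' : (0 : ℝ) < n := by exact_mod_cast hn0
  calc (f n n : ℝ) ≤ (n * (K - 1) : ℕ) := by exact_mod_cast hle
    _ = n * ((K : ℝ) - 1) := by rw [Nat.cast_mul, Nat.cast_sub hK2.le, Nat.cast_one]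
    _ < n * ((2 + ε) * s) := by
      gcongr
      nlinarith
    _ = (2 + ε) * n * s := by ring
end
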